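/- Main Theorem, planar case: Let X ⊆ ℝ² be a generic Delaunay set with parameters 0 < r < R, let D be a triangulation of X all of whose triangles are empty (the Delaunay triangulation of X), and let T be a uniformly bounded triangulation of X with parameter q. Let F be a real-valued functional on triangles such that e ≤ F(Δ) ≤ E for every triangle Δ whose edges have length at least 2r and whose circumradius is at most max(q,R), and suppose F satisfies the flip condition: for every generic set Y of 4 points in ℝ² in convex position, if {Δ₁, Δ₂} is the triangulation of the convex quadrilateral spanned by Y whose two triangles are empty with respect to Y, and {Δ₁', Δ₂'} is the other triangulation of the quadrilateral, then F(Δ₁) + F(Δ₂) ≤ F(Δ₁') + F(Δ₂'). Then the densities satisfy f(D) ≤ f(T). -/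

import Mathlib

open Metric MeasureTheory Filter

noncomputable section

/-- A Delaunay set with parameters `r < R`: every open ball of radius `r` contains at most
one point of `X`, and every closed ball of radius `R` contains at least one point of `X`. -/
def DelaunaySet (d : ℕ) (X : Set (EuclideanSpace ℝ (Fin d))) (r R : ℝ) : Prop :=
  (∀ z : EuclideanSpace ℝ (Fin d), (X ∩ Metric.ball z r).Subsingleton) ∧
  (∀ z : EuclideanSpace ℝ (Fin d), (X ∩ Metric.closedBall z R).Nonempty)

/-- `T` is a triangulation of `X`: a simplicial complex with vertex set exactly `X`
whose underlying space is all of `ℝ^d`. -/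
def IsTriangulationOf (d : ℕ) (T : Geometry.SimplicialComplex ℝ (EuclideanSpace ℝ (Fin d)))
    (X : Set (EuclideanSpace ℝ (Fin d))) : Prop :=
  T.vertices = X ∧ T.space = Set.univ

/-- The finset `s` admits an enclosing sphere with radius at most `q` passing through all
its vertices; for a `d`-simplex in `ℝ^d` this says its circumradius is at most `q`. -/
def HasCircumradiusLE (d : ℕ) (s : Finset (EuclideanSpace ℝ (Fin d))) (q : ℝ) : Prop :=
  ∃ c : EuclideanSpace ℝ (Fin d), ∃ ρ : ℝ, ρ ≤ q ∧ ∀ v ∈ s, dist v c = ρ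

/-- `T` is uniformly bounded with parameter `q`: every `d`-simplex of `T` has
circumradius at most `q`. -/
def UniformlyBounded (d : ℕ) (T : Geometry.SimplicialComplex ℝ (EuclideanSpace ℝ (Fin d)))
    (q : ℝ) : Prop :=
  ∀ s ∈ T.faces, s.card = d + 1 → HasCircumradiusLE d s q

/-- The density of a functional `F` on a triangulation `T`: the lower limit, as `α → ∞`,
of the sum of `F` over the `d`-simplices of `T` contained in the closed ball of radius `α`
about the origin, divided by the volume of that ball. -/
def density (d : ℕ) (F : Finset (EuclideanSpace ℝ (Fin d)) → ℝ)
    (T : Geometry.SimplicialComplex ℝ (EuclideanSpace ℝ (Fin d))) : ℝ :=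
  Filter.liminf (fun α : ℝ =>
    (∑ᶠ s ∈ {s : Finset (EuclideanSpace ℝ (Fin d)) |
        s ∈ T.faces ∧ s.card = d + 1 ∧
          (s : Set (EuclideanSpace ℝ (Fin d))) ⊆ Metric.closedBall 0 α},
      F s) /
    (MeasureTheory.volume (Metric.closedBall (0 : EuclideanSpace ℝ (Fin d)) α)).toReal)
    Filter.atTop

/-- `X` is generic: no `d+2` points of `X` lie on a common `(d-1)`-sphere. -/
def Generic (d : ℕ) (X : Set (EuclideanSpace ℝ (Fin d))) : Prop :=
  ∀ Y : Finset (EuclideanSpace ℝ (Fin d)), ↑Y ⊆ X →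
    (∃ c ρ, ∀ y ∈ Y, dist y c = ρ) → Y.card ≤ d + 1

/-- The simplex with vertex set `s` is empty with respect to `X`: the open ball bounded by
a sphere through all vertices of `s` contains no point of `X`. -/
def EmptySimplex (d : ℕ) (s : Finset (EuclideanSpace ℝ (Fin d)))
    (X : Set (EuclideanSpace ℝ (Fin d))) : Prop :=
  ∃ c ρ, (∀ v ∈ s, dist v c = ρ) ∧ ∀ x ∈ X, ρ ≤ dist x c

/-- `D` is a Delaunay triangulation of `X`: a triangulation all of whose `d`-simplices
are empty. -/
def IsDelaunayTriangulation (d : ℕ)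
    (D : Geometry.SimplicialComplex ℝ (EuclideanSpace ℝ (Fin d)))
    (X : Set (EuclideanSpace ℝ (Fin d))) : Prop :=
  IsTriangulationOf d D X ∧ ∀ s ∈ D.faces, s.card = d + 1 → EmptySimplex d s X

/-- The Euclidean plane. -/
abbrev Plane := EuclideanSpace ℝ (Fin 2)

/-- Twice the signed area of the triangle `abc`. -/
def orient (a b c : Plane) : ℝ :=
  (b 0 - a 0) * (c 1 - a 1) - (b 1 - a 1) * (c 0 - a 0)

/-- The power of the point `x` with respect to the circle with center `o` and radius `ρ`. -/
def circlePower (o : Plane) (ρ : ℝ) (x : Plane) : ℝ := dist x o ^ 2 - ρ ^ 2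

lemma plane_dist_sq (x y : Plane) : dist x y ^ 2 = (x 0 - y 0) ^ 2 + (x 1 - y 1) ^ 2 := by
  rw [EuclideanSpace.dist_eq, Real.sq_sqrt (by positivity), Fin.sum_univ_two, Real.dist_eq,
    Real.dist_eq, sq_abs, sq_abs]

lemma circlePower_eq (o : Plane) (ρ : ℝ) (x : Plane) :
    circlePower o ρ x = (x 0 - o 0) ^ 2 + (x 1 - o 1) ^ 2 - ρ ^ 2 := by
  rw [circlePower, plane_dist_sq]

lemma circlePower_eq_zero {o x : Plane} {ρ : ℝ} (h : dist x o = ρ) : circlePower o ρ x = 0 := by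
  rw [circlePower, h, sub_self]

lemma dist_eq_of_circlePower {o x : Plane} {ρ : ℝ} (hρ : 0 ≤ ρ) (h : circlePower o ρ x = 0) :
    dist x o = ρ := by
  rw [circlePower, sub_eq_zero] at h
  exact (pow_left_inj₀ dist_nonneg hρ two_ne_zero).1 h

lemma circlePower_nonneg_iff {o x : Plane} {ρ : ℝ} (hρ : 0 ≤ ρ) :
    0 ≤ circlePower o ρ x ↔ ρ ≤ dist x o := by
  rw [circlePower, sub_nonneg]
  exact pow_le_pow_iff_left₀ hρ dist_nonneg two_ne_zero

lemma circlePower_neg_iff {o x : Plane} {ρ : ℝ} (hρ : 0 ≤ ρ) :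
    circlePower o ρ x < 0 ↔ dist x o < ρ := by
  rw [← not_le, circlePower_nonneg_iff hρ, not_le]

lemma orient_rotate (a b c : Plane) : orient b c a = orient a b c := by
  unfold orient; ring

lemma orient_swap (a b c : Plane) : orient b a c = -orient a b c := by
  unfold orient; ring

lemma orient_self_left (a b : Plane) : orient a a b = 0 := by
  unfold orient; ring

lemma orient_self_right (a b : Plane) : orient a b b = 0 := by
  unfold orient; ring

lemma orient_self_outer (a b : Plane) : orient a b a = 0 := by
  unfold orient; ring

lemma orient_add (a b c x : Plane) :
    orient a b x + orient b c x + orient c a x = orient a b c := by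
  unfold orient; ring

lemma circlePower_barycentric (o o' : Plane) (ρ ρ' : ℝ) (a b c x : Plane) :
    (circlePower o ρ x - circlePower o' ρ' x) * orient a b c =
      (circlePower o ρ a - circlePower o' ρ' a) * orient b c x +
      (circlePower o ρ b - circlePower o' ρ' b) * orient c a x +
      (circlePower o ρ c - circlePower o' ρ' c) * orient a b x := by
  simp only [circlePower_eq, orient]; ring

lemma ne_of_orient_pos {a b c : Plane} (h : 0 < orient a b c) : a ≠ b ∧ b ≠ c ∧ a ≠ c := by
  refine ⟨?_, ?_, ?_⟩ <;> rintro rfl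
  · simp [orient_self_left] at h
  · simp [orient_self_right] at h
  · simp [orient_self_outer] at h

section Triangles
open scoped Classical

lemma orient_pos_perm {a b c a' b' c' : Plane} (h : ({a', b', c'} : Finset Plane) = {a, b, c})
    (h1 : 0 < orient a' b' c') (h2 : 0 < orient a b c) :
    (a' = a ∧ b' = b ∧ c' = c) ∨ (a' = b ∧ b' = c ∧ c' = a) ∨ (a' = c ∧ b' = a ∧ c' = b) := by
  have ha : a' ∈ ({a, b, c} : Finset Plane) := h ▸ by simp
  have hb : b' ∈ ({a, b, c} : Finset Plane) := h ▸ by simp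
  have hc : c' ∈ ({a, b, c} : Finset Plane) := h ▸ by simp
  simp only [Finset.mem_insert, Finset.mem_singleton] at ha hb hc
  have e1 := orient_rotate a b c
  have e2 := orient_rotate b c a
  have e3 := orient_swap a b c
  have e4 := orient_swap b c a
  have e5 := orient_swap c a b
  obtain ⟨n1, n2, n3⟩ := ne_of_orient_pos h1
  rcases ha with rfl | rfl | rfl <;> rcases hb with rfl | rfl | rfl <;>
    rcases hc with rfl | rfl | rfl <;>
    first
    | (exfalso; linarith)
    | exact (n1 rfl).elim
    | exact (n2 rfl).elim
    | exact (n3 rfl).elim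
    | simp

/-- `p` lies in the interior of the triangle with vertex set `s`. -/
def InTriangle (s : Finset Plane) (p : Plane) : Prop :=
  ∃ a b c, s = {a, b, c} ∧ 0 < orient a b p ∧ 0 < orient b c p ∧ 0 < orient c a p

lemma inTriangle_iff {a b c p : Plane} (h : 0 < orient a b c) :
    InTriangle {a, b, c} p ↔ 0 < orient a b p ∧ 0 < orient b c p ∧ 0 < orient c a p := by
  constructor
  · rintro ⟨a', b', c', hs, h1, h2, h3⟩
    have h' : 0 < orient a' b' c' := by rw [← orient_add a' b' c' p]; positivity
    rcases orient_pos_perm hs.symm h' h with ⟨rfl, rfl, rfl⟩ | ⟨rfl, rfl, rfl⟩ | ⟨rfl, rfl, rfl⟩ <;>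
      exact ⟨by assumption, by assumption, by assumption⟩
  · rintro ⟨h1, h2, h3⟩
    exact ⟨a, b, c, rfl, h1, h2, h3⟩

lemma triple_rotate (a b c : Plane) : ({b, c, a} : Finset Plane) = {a, b, c} := by
  ext x; simp; tauto

lemma triple_swap (a b c : Plane) : ({b, a, c} : Finset Plane) = {a, b, c} := by
  ext x; simp; tauto

/-- The points on no line spanned by two points of `X`. -/
def offLines (X : Set Plane) : Set Plane :=
  {p | ∀ a ∈ X, ∀ b ∈ X, a ≠ b → orient a b p ≠ 0}

/-- A family of triangles with vertices in `X` that tile the plane edge to edge, all of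
circumradius at most `Q`. -/
structure IsMesh (X : Set Plane) (Q : ℝ) (𝒯 : Set (Finset Plane)) : Prop where
  tri : ∀ s ∈ 𝒯, ∃ a b c, s = {a, b, c} ∧ 0 < orient a b c
  sub : ∀ s ∈ 𝒯, ∀ x ∈ s, x ∈ X
  rad : ∀ s ∈ 𝒯, HasCircumradiusLE 2 s Q
  vert : ∀ a b c, {a, b, c} ∈ 𝒯 → 0 < orient a b c → ∀ x ∈ X, 0 ≤ orient a b x →
    0 ≤ orient b c x → 0 ≤ orient c a x → x = a ∨ x = b ∨ x = c
  nbr : ∀ u v w, {u, v, w} ∈ 𝒯 → 0 < orient u v w → ∃ z, {z, w, v} ∈ 𝒯 ∧ 0 < orient z w v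
  cov : ∀ p ∈ offLines X, ∃! s, s ∈ 𝒯 ∧ InTriangle s p

lemma continuous_orient (a b : Plane) : Continuous (orient a b) := by
  unfold orient; fun_prop

lemma isOpen_orient_pos (a b : Plane) : IsOpen {p | 0 < orient a b p} :=
  isOpen_lt continuous_const (continuous_orient a b)

/-- The point `b - a` rotated by a quarter turn and based at `p`, at scale `t`. -/
def pushLeft (a b p : Plane) (t : ℝ) : Plane := !₂[p 0 - t * (b 1 - a 1), p 1 + t * (b 0 - a 0)]

lemma orient_pushLeft (a b p : Plane) (t : ℝ) :
    orient a b (pushLeft a b p t) = orient a b p + t * dist b a ^ 2 := by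
  rw [plane_dist_sq]; simp [orient, pushLeft]; ring

lemma continuous_pushLeft (a b p : Plane) : Continuous (pushLeft a b p) := by
  unfold pushLeft; fun_prop

lemma pushLeft_zero (a b p : Plane) : pushLeft a b p 0 = p := by
  ext i; fin_cases i <;> simp [pushLeft]

lemma mem_closure_orient_pos {a b p : Plane} (hab : a ≠ b) (h : orient a b p = 0) :
    p ∈ closure {x | 0 < orient a b x} := by
  have h1 : Tendsto (pushLeft a b p) (nhdsWithin 0 (Set.Ioi 0)) (nhds p) := by
    have := (continuous_pushLeft a b p).tendsto 0
    rw [pushLeft_zero] at this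
    exact this.mono_left nhdsWithin_le_nhds
  refine mem_closure_of_tendsto h1 ?_
  filter_upwards [self_mem_nhdsWithin] with t ht
  have : 0 < dist b a := dist_pos.2 hab.symm
  have ht : 0 < t := ht
  simp only [orient_pushLeft, h]
  positivity

lemma dense_offLines {X : Set Plane} (hX : X.Countable) : Dense (offLines X) := by
  have : offLines X = ⋂ e ∈ (X ×ˢ X) ∩ {e : Plane × Plane | e.1 ≠ e.2},
      {p | orient e.1 e.2 p ≠ 0} := by
    ext p
    simp only [offLines, Set.mem_ofPred_eq, Set.mem_iInter, Set.mem_inter_iff, Set.mem_prod]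
    exact ⟨fun h e he => h _ he.1.1 _ he.1.2 he.2, fun h a ha b hb hab => h (a, b) ⟨⟨ha, hb⟩, hab⟩⟩
  rw [this]
  refine dense_biInter_of_isOpen ?_ ((hX.prod hX).mono Set.inter_subset_left) ?_
  · intro e _
    exact isOpen_ne_fun (continuous_orient _ _) continuous_const
  · intro e he p
    by_cases hp : orient e.1 e.2 p = 0
    · exact closure_mono (fun x hx => ne_of_gt hx) (mem_closure_orient_pos he.2 hp)
    · exact subset_closure hp

lemma exists_offLines_inTriangle {X : Set Plane} (hX : X.Countable) {a b c : Plane}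
    (h : 0 < orient a b c) {p : Plane} (hp : 0 < orient a b p ∧ 0 < orient b c p ∧ 0 < orient c a p)
    {U : Set Plane} (hU : IsOpen U) (hpU : p ∈ U) :
    ∃ x ∈ offLines X, InTriangle {a, b, c} x ∧ x ∈ U := by
  have ho : IsOpen (({x | 0 < orient a b x} ∩ ({x | 0 < orient b c x} ∩ {x | 0 < orient c a x}))
      ∩ U) :=
    ((isOpen_orient_pos a b).inter ((isOpen_orient_pos b c).inter (isOpen_orient_pos c a))).inter hU
  obtain ⟨x, hx, hx'⟩ := (dense_offLines hX).exists_mem_open ho ⟨p, hp, hpU⟩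
  exact ⟨x, hx, (inTriangle_iff h).2 hx'.1, hx'.2⟩

lemma exists_offLines_inTriangle' {X : Set Plane} (hX : X.Countable) {a b c : Plane}
    (h : 0 < orient a b c) : ∃ x ∈ offLines X, InTriangle {a, b, c} x := by
  obtain ⟨x, hx, h', -⟩ := exists_offLines_inTriangle hX h
    (p := !₂[(a 0 + b 0 + c 0) / 3, (a 1 + b 1 + c 1) / 3])
    (by unfold orient at h ⊢; simp; refine ⟨?_, ?_, ?_⟩ <;> linarith) isOpen_univ trivial
  exact ⟨x, hx, h'⟩

lemma IsMesh.left_unique {X : Set Plane} {Q : ℝ} {𝒯 : Set (Finset Plane)} (hX : X.Countable)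
    (hT : IsMesh X Q 𝒯) {u u' v w : Plane} (h1 : {u, v, w} ∈ 𝒯) (h2 : 0 < orient u v w)
    (h1' : {u', v, w} ∈ 𝒯) (h2' : 0 < orient u' v w) : u = u' := by
  have hU : IsOpen ({x | 0 < orient u' v x} ∩ ({x | 0 < orient v w x} ∩ {x | 0 < orient w u' x})) :=
    (isOpen_orient_pos _ _).inter ((isOpen_orient_pos _ _).inter (isOpen_orient_pos _ _))
  have key : ∃ t : ℝ, 0 < t ∧ t < 1 ∧
      0 < (1 - t) * orient u' v w + 2 * t * orient u' v u ∧
      0 < (1 - t) * orient u' v w + 2 * t * orient w u' u := by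
    have e1 : ∀ᶠ t in nhds (0 : ℝ), 0 < (1 - t) * orient u' v w + 2 * t * orient u' v u :=
      (Continuous.tendsto (by fun_prop) 0).eventually (lt_mem_nhds (by simpa using h2'))
    have e2 : ∀ᶠ t in nhds (0 : ℝ), 0 < (1 - t) * orient u' v w + 2 * t * orient w u' u :=
      (Continuous.tendsto (by fun_prop) 0).eventually (lt_mem_nhds (by simpa using h2'))
    have e3 : ∀ᶠ t in nhds (0 : ℝ), t < 1 := gt_mem_nhds one_pos
    obtain ⟨t, ht, ht'⟩ := (((e1.and (e2.and e3)).filter_mono nhdsWithin_le_nhds).and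
      (self_mem_nhdsWithin (a := (0 : ℝ)) (s := Set.Ioi 0))).exists
    exact ⟨t, ht', ht.2.2, ht.1, ht.2.1⟩
  obtain ⟨t, t0, t1, k1, k2⟩ := key
  have t1' : 0 < 1 - t := sub_pos.2 t1
  set p : Plane := !₂[(1 - t) * ((v 0 + w 0) / 2) + t * u 0, (1 - t) * ((v 1 + w 1) / 2) + t * u 1]
    with hp
  have q1 : orient u v p = (1 - t) / 2 * orient u v w := by simp [hp, orient]; ring
  have q2 : orient v w p = t * orient u v w := by simp [hp, orient]; ring
  have q3 : orient w u p = (1 - t) / 2 * orient u v w := by simp [hp, orient]; ring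
  have q4 : orient u' v p = ((1 - t) * orient u' v w + 2 * t * orient u' v u) / 2 := by
    simp [hp, orient]; ring
  have q5 : orient w u' p = ((1 - t) * orient u' v w + 2 * t * orient w u' u) / 2 := by
    simp [hp, orient]; ring
  obtain ⟨x, hx, hx1, hx2⟩ := exists_offLines_inTriangle hX h2 (p := p)
    ⟨by rw [q1]; positivity, by rw [q2]; positivity, by rw [q3]; positivity⟩ hU
    ⟨by simp only [Set.mem_ofPred_eq, q4]; linarith,
      by simp only [Set.mem_ofPred_eq, q2]; positivity,
      by simp only [Set.mem_ofPred_eq, q5]; linarith⟩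
  have he := (hT.cov x hx).unique ⟨h1, hx1⟩ ⟨h1', (inTriangle_iff h2').2 hx2⟩
  rcases orient_pos_perm he h2 h2' with h | h | h
  · exact h.1
  · rw [h.1, h.2.1, orient_self_left] at h2; simp at h2
  · exfalso
    rw [h.2.2, orient_self_right] at h2; simp at h2

/-- Replace the triangles `abc`, `cbd` by `abd`, `adc`. -/
def flipMesh (𝒯 : Set (Finset Plane)) (a b c d : Plane) : Set (Finset Plane) :=
  {s | (s ∈ 𝒯 ∧ s ≠ {a, b, c} ∧ s ≠ {c, b, d}) ∨ s = {a, b, d} ∨ s = {a, d, c}}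

/-- `a`, `b`, `d`, `c` are the vertices of a convex quadrilateral in counterclockwise order. -/
structure ConvexQuad (a b c d : Plane) : Prop where
  abc : 0 < orient a b c
  cbd : 0 < orient c b d
  abd : 0 < orient a b d
  adc : 0 < orient a d c

namespace ConvexQuad

variable {a b c d x : Plane}

lemma symm (h : ConvexQuad a b c d) : ConvexQuad d c b a := by
  obtain ⟨h1, h2, h3, h4⟩ := h
  constructor <;> unfold orient at * <;> linarith

lemma rotate (h : ConvexQuad a b c d) : ConvexQuad c a d b := by
  obtain ⟨h1, h2, h3, h4⟩ := h
  constructor <;> unfold orient at * <;> linarith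

lemma nonneg_of_abd (h : ConvexQuad a b c d)
    (h1 : 0 ≤ orient a b x) (h2 : 0 ≤ orient b d x) (h3 : 0 ≤ orient d a x) :
    0 ≤ orient c a x ∧ 0 ≤ orient d c x := by
  have e1 : orient c a x * orient a b d = orient a b c * orient d a x +
      orient a d c * orient a b x := by unfold orient; ring
  have e2 : orient d c x * orient a b d = orient a d c * orient b d x +
      orient c b d * orient d a x := by unfold orient; ring
  obtain ⟨p1, p2, p3, p4⟩ := h
  exact ⟨nonneg_of_mul_nonneg_left (e1 ▸ by positivity) p3,
    nonneg_of_mul_nonneg_left (e2 ▸ by positivity) p3⟩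

lemma pos_of_abd (h : ConvexQuad a b c d)
    (h1 : 0 < orient a b x) (h2 : 0 < orient b d x) (h3 : 0 < orient d a x) :
    0 < orient c a x ∧ 0 < orient d c x := by
  have e1 : orient c a x * orient a b d = orient a b c * orient d a x +
      orient a d c * orient a b x := by unfold orient; ring
  have e2 : orient d c x * orient a b d = orient a d c * orient b d x +
      orient c b d * orient d a x := by unfold orient; ring
  obtain ⟨p1, p2, p3, p4⟩ := h
  exact ⟨pos_of_mul_pos_left (e1 ▸ by positivity) p3.le,
    pos_of_mul_pos_left (e2 ▸ by positivity) p3.le⟩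

lemma inTriangle_of_abd (h : ConvexQuad a b c d) (hx : orient b c x ≠ 0)
    (hx' : InTriangle {a, b, d} x) : InTriangle {a, b, c} x ∨ InTriangle {c, b, d} x := by
  obtain ⟨h1, h2, h3⟩ := (inTriangle_iff h.abd).1 hx'
  obtain ⟨h4, h5⟩ := h.pos_of_abd h1 h2 h3
  rcases hx.lt_or_gt with h6 | h6
  · right
    refine (inTriangle_iff h.cbd).2 ⟨?_, h2, h5⟩
    rw [orient_swap]; linarith
  · exact Or.inl ((inTriangle_iff h.abc).2 ⟨h1, h6, h4⟩)

lemma inTriangle_of_adc (h : ConvexQuad a b c d) (hx : orient b c x ≠ 0)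
    (hx' : InTriangle {a, d, c} x) : InTriangle {a, b, c} x ∨ InTriangle {c, b, d} x := by
  rw [← triple_rotate] at hx'
  have := h.symm.inTriangle_of_abd (x := x) (by rwa [orient_swap, neg_ne_zero]) hx'
  rw [← triple_rotate a b c, ← triple_rotate c b d, ← triple_rotate b d c]
  exact this.symm

lemma inTriangle_of_abc (h : ConvexQuad a b c d) (hx : orient a d x ≠ 0)
    (hx' : InTriangle {a, b, c} x) : InTriangle {a, b, d} x ∨ InTriangle {a, d, c} x := by
  rw [← triple_rotate, ← triple_rotate] at hx'
  have := h.rotate.inTriangle_of_abd (x := x) hx hx'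
  rw [← triple_rotate a d c, ← triple_rotate d c a, ← triple_rotate a b d, ← triple_rotate b d a]
  exact this.symm

lemma inTriangle_of_cbd (h : ConvexQuad a b c d) (hx : orient a d x ≠ 0)
    (hx' : InTriangle {c, b, d} x) : InTriangle {a, b, d} x ∨ InTriangle {a, d, c} x := by
  rw [← triple_rotate, ← triple_rotate] at hx'
  have := h.symm.inTriangle_of_abc (x := x) (by rwa [orient_swap, neg_ne_zero])
    hx'
  rw [← triple_rotate a d c, ← triple_rotate a b d, ← triple_rotate b d a]
  exact this.symm

lemma not_both (h : ConvexQuad a b c d)  :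
    ¬ (InTriangle {a, b, d} x ∧ InTriangle {a, d, c} x) := by
  rintro ⟨h1, h2⟩
  have h1 := ((inTriangle_iff h.abd).1 h1).2.2
  have h2 := ((inTriangle_iff h.adc).1 h2).1
  rw [orient_swap] at h1
  linarith

end ConvexQuad

lemma IsMesh.abd_notMem {X : Set Plane} {Q : ℝ} {𝒯 : Set (Finset Plane)} (hX : X.Countable)
    (hT : IsMesh X Q 𝒯) {a b c d : Plane} (h : ConvexQuad a b c d)
    (h1 : {a, b, c} ∈ 𝒯) : {a, b, d} ∉ 𝒯 := by
  intro h3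
  have := hT.left_unique hX (u := c) (u' := d) (v := a) (w := b) (by rwa [← triple_rotate])
    (by rw [← orient_rotate]; exact h.abc) (by rwa [← triple_rotate])
    (by rw [← orient_rotate]; exact h.abd)
  exact (ne_of_orient_pos h.cbd).2.2 this

lemma IsMesh.adc_notMem {X : Set Plane} {Q : ℝ} {𝒯 : Set (Finset Plane)} (hX : X.Countable)
    (hT : IsMesh X Q 𝒯) {a b c d : Plane} (h : ConvexQuad a b c d)
    (h2 : {c, b, d} ∈ 𝒯) : {a, d, c} ∉ 𝒯 := by
  rw [← triple_rotate]
  exact hT.abd_notMem hX h.symm (by rwa [← triple_rotate d c b])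

lemma IsMesh.flipMesh_cov {X : Set Plane} {Q : ℝ} {𝒯 : Set (Finset Plane)}
    (hT : IsMesh X Q 𝒯) {a b c d : Plane} (h : ConvexQuad a b c d)
    (h1 : {a, b, c} ∈ 𝒯) (h2 : {c, b, d} ∈ 𝒯) :
    ∀ p ∈ offLines X, ∃! s, s ∈ flipMesh 𝒯 a b c d ∧ InTriangle s p := by
  intro p hp
  have ha : a ∈ X := hT.sub _ h1 a (by simp)
  have hb : b ∈ X := hT.sub _ h1 b (by simp)
  have hc : c ∈ X := hT.sub _ h1 c (by simp)
  have hd : d ∈ X := hT.sub _ h2 d (by simp)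
  have n1 := hp a ha d hd (ne_of_orient_pos h.abd).2.2
  have n2 := hp b hb c hc (ne_of_orient_pos h.abc).2.1
  obtain ⟨s, ⟨hs, hsp⟩, hu⟩ := hT.cov p hp
  by_cases hq : InTriangle {a, b, d} p ∨ InTriangle {a, d, c} p
  · have hs' : s = {a, b, c} ∨ s = {c, b, d} := by
      have : InTriangle {a, b, c} p ∨ InTriangle {c, b, d} p :=
        hq.elim (h.inTriangle_of_abd n2) (h.inTriangle_of_adc n2)
      exact this.imp (fun h => (hu _ ⟨h1, h⟩).symm) (fun h => (hu _ ⟨h2, h⟩).symm)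
    have old : ∀ t, t ∈ 𝒯 ∧ t ≠ {a, b, c} ∧ t ≠ {c, b, d} → ¬ InTriangle t p := by
      rintro t ⟨ht, t1, t2⟩ hi
      have := hu t ⟨ht, hi⟩
      rcases hs' with h | h
      · exact t1 (this.trans h)
      · exact t2 (this.trans h)
    rcases hq with hq | hq
    · refine ⟨_, ⟨Or.inr (Or.inl rfl), hq⟩, ?_⟩
      rintro t ⟨ht | ht | ht, hi⟩
      · exact (old t ht hi).elim
      · exact ht
      · exact (h.not_both ⟨hq, ht ▸ hi⟩).elim
    · refine ⟨_, ⟨Or.inr (Or.inr rfl), hq⟩, ?_⟩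
      rintro t ⟨ht | ht | ht, hi⟩
      · exact (old t ht hi).elim
      · exact (h.not_both ⟨ht ▸ hi, hq⟩).elim
      · exact ht
  · refine ⟨s, ⟨Or.inl ⟨hs, ?_, ?_⟩, hsp⟩, ?_⟩
    · rintro rfl; exact hq (h.inTriangle_of_abc n1 hsp)
    · rintro rfl; exact hq (h.inTriangle_of_cbd n1 hsp)
    · rintro t ⟨ht | rfl | rfl, hi⟩
      · exact hu t ⟨ht.1, hi⟩
      · exact (hq (Or.inl hi)).elim
      · exact (hq (Or.inr hi)).elim

lemma IsMesh.vert_abd {X : Set Plane} {Q : ℝ} {𝒯 : Set (Finset Plane)}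
    (hT : IsMesh X Q 𝒯) {a b c d : Plane} (h : ConvexQuad a b c d)
    (h1 : {a, b, c} ∈ 𝒯) (h2 : {c, b, d} ∈ 𝒯) {x : Plane} (hx : x ∈ X)
    (x1 : 0 ≤ orient a b x) (x2 : 0 ≤ orient b d x) (x3 : 0 ≤ orient d a x) :
    x = a ∨ x = b ∨ x = d := by
  obtain ⟨x4, x5⟩ := h.nonneg_of_abd x1 x2 x3
  have hxc : x ≠ c := by
    rintro rfl
    have := h.adc
    rw [orient_swap] at x3; linarith
  rcases le_total 0 (orient b c x) with x6 | x6
  · have := hT.vert a b c h1 h.abc x hx x1 x6 x4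
    tauto
  · have := hT.vert c b d h2 h.cbd x hx (by rw [orient_swap]; linarith) x2 x5
    tauto

lemma IsMesh.flipMesh_vert {X : Set Plane} {Q : ℝ} {𝒯 : Set (Finset Plane)}
    (hT : IsMesh X Q 𝒯) {a b c d : Plane} (h : ConvexQuad a b c d)
    (h1 : {a, b, c} ∈ 𝒯) (h2 : {c, b, d} ∈ 𝒯) (u v w : Plane) (hs : {u, v, w} ∈ flipMesh 𝒯 a b c d)
    (hp : 0 < orient u v w) (x : Plane) (hx : x ∈ X) (x1 : 0 ≤ orient u v x)
    (x2 : 0 ≤ orient v w x) (x3 : 0 ≤ orient w u x) : x = u ∨ x = v ∨ x = w := by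
  rcases hs with hs | hs | hs
  · exact hT.vert u v w hs.1 hp x hx x1 x2 x3
  · have := hT.vert_abd h h1 h2 hx
    rcases orient_pos_perm hs hp h.abd with ⟨rfl, rfl, rfl⟩ | ⟨rfl, rfl, rfl⟩ | ⟨rfl, rfl, rfl⟩ <;>
      tauto
  · have := hT.vert_abd h.symm (by rwa [← triple_rotate d c b]) (by rwa [triple_rotate a b c]) hx
    rcases orient_pos_perm hs hp h.adc with ⟨rfl, rfl, rfl⟩ | ⟨rfl, rfl, rfl⟩ | ⟨rfl, rfl, rfl⟩ <;>
      tauto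

lemma IsMesh.flipMesh_nbr {X : Set Plane} {Q : ℝ} {𝒯 : Set (Finset Plane)} (hX : X.Countable)
    (hT : IsMesh X Q 𝒯) {a b c d : Plane} (h : ConvexQuad a b c d)
    (h1 : {a, b, c} ∈ 𝒯) (h2 : {c, b, d} ∈ 𝒯) (u v w : Plane) (hs : {u, v, w} ∈ flipMesh 𝒯 a b c d)
    (hp : 0 < orient u v w) : ∃ z, {z, w, v} ∈ flipMesh 𝒯 a b c d ∧ 0 < orient z w v := by
  obtain ⟨nab, nbc, nac⟩ := ne_of_orient_pos h.abc
  obtain ⟨ncb, nbd, ncd⟩ := ne_of_orient_pos h.cbd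
  have nad := (ne_of_orient_pos h.abd).2.2
  have m1 : {a, b, d} ∈ flipMesh 𝒯 a b c d := Or.inr (Or.inl rfl)
  have m2 : {a, d, c} ∈ flipMesh 𝒯 a b c d := Or.inr (Or.inr rfl)
  -- away from the new diagonal, every directed edge was there before the flip
  have old : (∃ z, {z, w, v} ∈ 𝒯 ∧ 0 < orient z w v) ∨ (v = a ∧ w = d) ∨ (v = d ∧ w = a) := by
    rcases hs with hs | hs | hs
    · exact Or.inl (hT.nbr u v w hs.1 hp)
    · rcases orient_pos_perm hs hp h.abd with ⟨rfl, rfl, rfl⟩ | ⟨rfl, rfl, rfl⟩ | ⟨rfl, rfl, rfl⟩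
      · exact Or.inl (hT.nbr c v w h2 h.cbd)
      · simp
      · exact Or.inl (hT.nbr c v w (by rwa [← triple_rotate])
          (by rw [← orient_rotate]; exact h.abc))
    · rcases orient_pos_perm hs hp h.adc with ⟨rfl, rfl, rfl⟩ | ⟨rfl, rfl, rfl⟩ | ⟨rfl, rfl, rfl⟩
      · exact Or.inl (hT.nbr b v w (by rwa [triple_rotate w b v])
          (by rw [orient_rotate w b v]; exact h.cbd))
      · exact Or.inl (hT.nbr b v w (by rwa [triple_rotate]) (by rw [orient_rotate]; exact h.abc))
      · simp
  -- the old diagonal is gone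
  have gone : ¬ (v = c ∧ w = b) ∧ ¬ (v = b ∧ w = c) := by
    constructor
    · rintro ⟨rfl, rfl⟩
      rcases hs with hs | hs | hs
      · have := hT.left_unique hX hs.1 hp (u' := d) (by rwa [← triple_rotate])
          (by rw [← orient_rotate]; exact h.cbd)
        subst this
        exact hs.2.2 (triple_rotate _ _ _).symm
      · have : v ∈ ({a, w, d} : Finset Plane) := hs ▸ by simp
        simp only [Finset.mem_insert, Finset.mem_singleton] at this
        tauto
      · have : w ∈ ({a, d, v} : Finset Plane) := hs ▸ by simp
        simp only [Finset.mem_insert, Finset.mem_singleton] at this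
        tauto
    · rintro ⟨rfl, rfl⟩
      rcases hs with hs | hs | hs
      · have := hT.left_unique hX hs.1 hp h1 h.abc
        subst this
        exact hs.2.1 rfl
      · have : w ∈ ({a, v, d} : Finset Plane) := hs ▸ by simp
        simp only [Finset.mem_insert, Finset.mem_singleton] at this
        tauto
      · have : v ∈ ({a, d, w} : Finset Plane) := hs ▸ by simp
        simp only [Finset.mem_insert, Finset.mem_singleton] at this
        tauto
  rcases old with ⟨z, hz, hz'⟩ | ⟨rfl, rfl⟩ | ⟨rfl, rfl⟩
  · by_cases e1 : ({z, w, v} : Finset Plane) = {a, b, c}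
    · rcases orient_pos_perm e1 hz' h.abc with ⟨rfl, rfl, rfl⟩ | ⟨rfl, rfl, rfl⟩ | ⟨rfl, rfl, rfl⟩
      · tauto
      · exact ⟨d, by rwa [triple_rotate v d w], by rw [orient_rotate v d w]; exact h.adc⟩
      · exact ⟨d, by rwa [← triple_rotate], by rw [← orient_rotate]; exact h.abd⟩
    · by_cases e2 : ({z, w, v} : Finset Plane) = {c, b, d}
      · rcases orient_pos_perm e2 hz' h.cbd with ⟨rfl, rfl, rfl⟩ | ⟨rfl, rfl, rfl⟩ | ⟨rfl, rfl, rfl⟩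
        · exact ⟨a, m1, h.abd⟩
        · exact ⟨a, m2, h.adc⟩
        · tauto
      · exact ⟨z, Or.inl ⟨hz, e1, e2⟩, hz'⟩
  · exact ⟨b, by rwa [triple_rotate], by rw [orient_rotate]; exact h.abd⟩
  · exact ⟨c, by rwa [← triple_rotate], by rw [← orient_rotate]; exact h.adc⟩

lemma IsMesh.isMesh_flipMesh {X : Set Plane} {Q : ℝ} {𝒯 : Set (Finset Plane)} (hX : X.Countable)
    (hT : IsMesh X Q 𝒯) {a b c d : Plane} (h : ConvexQuad a b c d)
    (h1 : {a, b, c} ∈ 𝒯) (h2 : {c, b, d} ∈ 𝒯) (r1 : HasCircumradiusLE 2 {a, b, d} Q)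
    (r2 : HasCircumradiusLE 2 {a, d, c} Q) : IsMesh X Q (flipMesh 𝒯 a b c d) where
  tri := by
    rintro s (hs | rfl | rfl)
    · exact hT.tri s hs.1
    · exact ⟨a, b, d, rfl, h.abd⟩
    · exact ⟨a, d, c, rfl, h.adc⟩
  sub := by
    have ha : a ∈ X := hT.sub _ h1 a (by simp)
    have hb : b ∈ X := hT.sub _ h1 b (by simp)
    have hc : c ∈ X := hT.sub _ h1 c (by simp)
    have hd : d ∈ X := hT.sub _ h2 d (by simp)
    rintro s (hs | rfl | rfl)
    · exact hT.sub s hs.1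
    · simp [ha, hb, hd]
    · simp [ha, hc, hd]
  rad := by
    rintro s (hs | rfl | rfl)
    · exact hT.rad s hs.1
    · exact r1
    · exact r2
  vert := hT.flipMesh_vert h h1 h2
  nbr := hT.flipMesh_nbr hX h h1 h2
  cov := hT.flipMesh_cov h h1 h2

lemma exists_circumcircle {a b c : Plane} (h : orient a b c ≠ 0) :
    ∃ (o : Plane) (ρ : ℝ), dist a o = ρ ∧ dist b o = ρ ∧ dist c o = ρ := by
  set B := (b 0 - a 0) ^ 2 + (b 1 - a 1) ^ 2 with hB
  set C := (c 0 - a 0) ^ 2 + (c 1 - a 1) ^ 2 with hC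
  set x := ((c 1 - a 1) * B - (b 1 - a 1) * C) / (2 * orient a b c) with hx
  set y := ((b 0 - a 0) * C - (c 0 - a 0) * B) / (2 * orient a b c) with hy
  have e1 : 2 * ((b 0 - a 0) * x + (b 1 - a 1) * y) = B := by
    rw [hx, hy]; field_simp; unfold orient; ring
  have e2 : 2 * ((c 0 - a 0) * x + (c 1 - a 1) * y) = C := by
    rw [hx, hy]; field_simp; unfold orient; ring
  refine ⟨!₂[a 0 + x, a 1 + y], _, rfl, ?_, ?_⟩
  · refine (pow_left_inj₀ dist_nonneg dist_nonneg two_ne_zero).1 ?_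
    simp only [plane_dist_sq]
    simp
    linear_combination -e1 + hB
  · refine (pow_left_inj₀ dist_nonneg dist_nonneg two_ne_zero).1 ?_
    simp only [plane_dist_sq]
    simp
    linear_combination -e2 + hC

lemma circumradius_le_of_power_sub {o o' : Plane} {ρ ρ' : ℝ} (hρ : 0 ≤ ρ)
    (h : circlePower o ρ o' - circlePower o' ρ' o' ≤ 0) : ρ' ≤ ρ := by
  rw [circlePower, circlePower, dist_self] at h
  refine abs_le_of_sq_le_sq' (a := ρ') (b := ρ) ?_ hρ |>.2
  have := sq_nonneg (dist o' o)
  linarith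

lemma exists_orient_nonneg_of_circumcenter {a b d o : Plane} {ρ : ℝ} (h : 0 < orient a b d)
    (ha : dist a o = ρ) (hb : dist b o = ρ) (hd : dist d o = ρ) :
    0 ≤ orient a b o ∨ 0 ≤ orient b d o := by
  by_contra! hc
  obtain ⟨nab, nbd, -⟩ := ne_of_orient_pos h
  have p1 : 0 < dist a b ^ 2 := by have := dist_pos.2 nab; positivity
  have p2 : 0 < dist d b ^ 2 := by have := dist_pos.2 nbd.symm; positivity
  have ha := circlePower_eq_zero ha
  have hb := circlePower_eq_zero hb
  have hd := circlePower_eq_zero hd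
  rw [circlePower_eq] at ha hb hd
  have key : 2 * dist o b ^ 2 * orient a b d =
      orient b d o * dist a b ^ 2 + orient a b o * dist d b ^ 2 := by
    simp only [plane_dist_sq]
    have f1 : 2 * ((a 0 - b 0) * (o 0 - b 0) + (a 1 - b 1) * (o 1 - b 1)) =
      (a 0 - b 0) ^ 2 + (a 1 - b 1) ^ 2 := by linear_combination hb - ha
    have f2 : 2 * ((d 0 - b 0) * (o 0 - b 0) + (d 1 - b 1) * (o 1 - b 1)) =
      (d 0 - b 0) ^ 2 + (d 1 - b 1) ^ 2 := by linear_combination hb - hd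
    rw [← f1, ← f2]
    unfold orient; ring
  have q1 := mul_neg_of_neg_of_pos hc.1 p2
  have q2 := mul_neg_of_neg_of_pos hc.2 p1
  have q3 : 0 ≤ 2 * dist o b ^ 2 * orient a b d := by positivity
  linarith

/-- The circumcircles of two triangles `abc`, `cbd` sharing an edge, the first of which has `d` in
its interior. -/
structure BadPair (a b c d o o' : Plane) (ρ ρ' : ℝ) : Prop where
  abc : 0 < orient a b c
  cbd : 0 < orient c b d
  ha : dist a o = ρ
  hb : dist b o = ρ
  hc : dist c o = ρ
  hc' : dist c o' = ρ'
  hb' : dist b o' = ρ'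
  hd' : dist d o' = ρ'
  bad : dist d o < ρ

namespace BadPair

variable {a b c d o o' : Plane} {ρ ρ' : ℝ}

lemma power_neg (h : BadPair a b c d o o' ρ ρ') : circlePower o ρ d < 0 :=
  (circlePower_neg_iff (h.ha ▸ dist_nonneg)).2 h.bad

lemma power_neg' (h : BadPair a b c d o o' ρ ρ') : circlePower o' ρ' a < 0 := by
  have e := circlePower_barycentric o o' ρ ρ' a b c d
  rw [circlePower_eq_zero h.ha, circlePower_eq_zero h.hb, circlePower_eq_zero h.hc,
    circlePower_eq_zero h.hb', circlePower_eq_zero h.hc', circlePower_eq_zero h.hd',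
    orient_swap c b d] at e
  have h1 := mul_neg_of_neg_of_pos h.power_neg h.abc
  have h2 := h.cbd
  by_contra! h3
  have := mul_nonneg h3 h2.le
  linarith

lemma symm (h : BadPair a b c d o o' ρ ρ') : BadPair d c b a o' o ρ' ρ where
  abc := by rw [← orient_rotate d c b]; exact h.cbd
  cbd := by rw [orient_rotate a b c]; exact h.abc
  ha := h.hd'
  hb := h.hc'
  hc := h.hb'
  hc' := h.hb
  hb' := h.hc
  hd' := h.ha
  bad := (circlePower_neg_iff (h.hc' ▸ dist_nonneg)).1 h.power_neg'

lemma orient_abd_pos (h : BadPair a b c d o o' ρ ρ') : 0 < orient a b d := by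
  by_contra! hn
  have h1 := h.power_neg
  have h2 := h.cbd
  have h3 := h.abc
  have ha := circlePower_eq_zero h.ha
  have hb := circlePower_eq_zero h.hb
  have hc := circlePower_eq_zero h.hc
  rw [circlePower_eq] at ha hb hc h1
  -- barycentric coordinates of `d` based at `b`
  have e0 : orient a b c * (d 0 - b 0) =
      -orient c b d * (a 0 - b 0) + orient a b d * (c 0 - b 0) := by unfold orient; ring
  have e1 : orient a b c * (d 1 - b 1) =
      -orient c b d * (a 1 - b 1) + orient a b d * (c 1 - b 1) := by unfold orient; ring
  have f1 : (a 0 - b 0) ^ 2 + (a 1 - b 1) ^ 2 =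
      2 * ((a 0 - b 0) * (o 0 - b 0) + (a 1 - b 1) * (o 1 - b 1)) := by linear_combination ha - hb
  have f2 : (c 0 - b 0) ^ 2 + (c 1 - b 1) ^ 2 =
      2 * ((c 0 - b 0) * (o 0 - b 0) + (c 1 - b 1) * (o 1 - b 1)) := by linear_combination hc - hb
  have key : ((d 0 - o 0) ^ 2 + (d 1 - o 1) ^ 2 - ρ ^ 2) * orient a b c =
      ((d 0 - b 0) ^ 2 + (d 1 - b 1) ^ 2) * orient a b c +
        orient c b d * ((a 0 - b 0) ^ 2 + (a 1 - b 1) ^ 2) -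
        orient a b d * ((c 0 - b 0) ^ 2 + (c 1 - b 1) ^ 2) := by
    rw [f1, f2]
    linear_combination orient a b c * hb - 2 * (o 0 - b 0) * e0 - 2 * (o 1 - b 1) * e1
  have l1 := mul_neg_of_neg_of_pos h1 h3
  have l2 : 0 ≤ -orient a b d * ((c 0 - b 0) ^ 2 + (c 1 - b 1) ^ 2) :=
    mul_nonneg (by linarith) (by positivity)
  have l3 : 0 ≤ ((d 0 - b 0) ^ 2 + (d 1 - b 1) ^ 2) * orient a b c := by positivity
  have l4 : 0 ≤ orient c b d * ((a 0 - b 0) ^ 2 + (a 1 - b 1) ^ 2) := by positivity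
  linarith

lemma convexQuad (h : BadPair a b c d o o' ρ ρ') : ConvexQuad a b c d where
  abc := h.abc
  cbd := h.cbd
  abd := h.orient_abd_pos
  adc := by
    have := h.symm.orient_abd_pos
    rwa [orient_rotate a d c] at this

lemma power_pos_of_abd (h : BadPair a b c d o o' ρ ρ') {o₁ : Plane} {ρ₁ : ℝ} (ha : dist a o₁ = ρ₁)
    (hb : dist b o₁ = ρ₁) (hd : dist d o₁ = ρ₁) : 0 < circlePower o₁ ρ₁ c := by
  have e := circlePower_barycentric o o₁ ρ ρ₁ a b d c
  rw [circlePower_eq_zero h.ha, circlePower_eq_zero h.hb, circlePower_eq_zero h.hc,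
    circlePower_eq_zero ha, circlePower_eq_zero hb, circlePower_eq_zero hd] at e
  have h1 := mul_neg_of_neg_of_pos h.power_neg h.abc
  by_contra! h3
  have := mul_nonneg_of_nonpos_of_nonpos h3 (neg_nonpos.2 h.orient_abd_pos.le)
  linarith

lemma radius_abd_le (h : BadPair a b c d o o' ρ ρ') {o₁ : Plane} {ρ₁ : ℝ} (ha : dist a o₁ = ρ₁)
    (hb : dist b o₁ = ρ₁) (hd : dist d o₁ = ρ₁) : ρ₁ ≤ ρ ∨ ρ₁ ≤ ρ' := by
  have h1 := h.orient_abd_pos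
  rcases exists_orient_nonneg_of_circumcenter h1 ha hb hd with h2 | h2
  · left
    refine circumradius_le_of_power_sub (h.ha ▸ dist_nonneg) (o := o) (o' := o₁) ?_
    have e := circlePower_barycentric o o₁ ρ ρ₁ a b d o₁
    rw [circlePower_eq_zero h.ha, circlePower_eq_zero h.hb,
      circlePower_eq_zero ha, circlePower_eq_zero hb, circlePower_eq_zero hd] at e
    have := mul_nonpos_of_nonpos_of_nonneg h.power_neg.le h2
    by_contra! h3
    have := mul_pos h3 h1
    linarith
  · right
    refine circumradius_le_of_power_sub (h.hc' ▸ dist_nonneg) (o := o') (o' := o₁) ?_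
    have e := circlePower_barycentric o' o₁ ρ' ρ₁ a b d o₁
    rw [circlePower_eq_zero h.hd', circlePower_eq_zero h.hb',
      circlePower_eq_zero ha, circlePower_eq_zero hb, circlePower_eq_zero hd] at e
    have := mul_nonpos_of_nonpos_of_nonneg h.power_neg'.le h2
    by_contra! h3
    have := mul_pos h3 h1
    linarith

lemma hasCircumradiusLE_abd (h : BadPair a b c d o o' ρ ρ') {Q : ℝ} (h1 : ρ ≤ Q) (h2 : ρ' ≤ Q) :
    HasCircumradiusLE 2 {a, b, d} Q := by
  obtain ⟨o₁, ρ₁, ha, hb, hd⟩ := exists_circumcircle h.orient_abd_pos.ne'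
  exact ⟨o₁, ρ₁, (h.radius_abd_le ha hb hd).elim (·.trans h1) (·.trans h2), by simp [ha, hb, hd]⟩

lemma hasCircumradiusLE_adc (h : BadPair a b c d o o' ρ ρ') {Q : ℝ} (h1 : ρ ≤ Q) (h2 : ρ' ≤ Q) :
    HasCircumradiusLE 2 {a, d, c} Q := by
  rw [← triple_rotate]
  exact h.symm.hasCircumradiusLE_abd h2 h1

lemma empty_abd (h : BadPair a b c d o o' ρ ρ') : EmptySimplex 2 {a, b, d} {a, b, d, c} := by
  obtain ⟨o₁, ρ₁, ha, hb, hd⟩ := exists_circumcircle h.orient_abd_pos.ne'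
  have := (circlePower_nonneg_iff (ha ▸ dist_nonneg)).1 (h.power_pos_of_abd ha hb hd).le
  exact ⟨o₁, ρ₁, by simp [ha, hb, hd], by simp [ha, hb, hd, this]⟩

lemma empty_adc (h : BadPair a b c d o o' ρ ρ') : EmptySimplex 2 {a, d, c} {a, b, d, c} := by
  have := h.symm.empty_abd
  rw [triple_rotate] at this
  convert this using 1
  ext x; simp; tauto

lemma diagonals_cross (h : BadPair a b c d o o' ρ ρ') :
    (openSegment ℝ a d ∩ openSegment ℝ b c).Nonempty := by
  obtain ⟨h1, h2, h3, h4⟩ := h.convexQuad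
  have h5 : orient a b d + orient a d c = orient a b c + orient c b d := by unfold orient; ring
  set S := orient a b c + orient c b d with hS
  have hSp : 0 < S := by positivity
  refine ⟨(orient c b d / S) • a + (orient a b c / S) • d,
    ⟨_, _, by positivity, by positivity, ?_, rfl⟩,
    ⟨orient a d c / S, orient a b d / S, by positivity, by positivity, ?_, ?_⟩⟩
  · rw [← add_div, add_comm, ← hS, div_self hSp.ne']
  · rw [← add_div, add_comm, h5, div_self hSp.ne']
  · ext i
    simp only [PiLp.add_apply, PiLp.smul_apply, smul_eq_mul]
    field_simp
    fin_cases i <;> simp [orient] <;> ring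

end BadPair

/-- Six times twice the volume below the lift of the triangle `s` to the paraboloid
`z = ‖x‖ ^ 2`. -/
def liftVolume (s : Finset Plane) : ℝ :=
  (∑ x ∈ s, ∑ y ∈ s, ∑ z ∈ s, |orient x y z|) * ∑ v ∈ s, (v 0 ^ 2 + v 1 ^ 2)

lemma liftVolume_eq {a b c : Plane} (h : 0 < orient a b c) :
    liftVolume {a, b, c} = 6 * orient a b c *
      ((a 0 ^ 2 + a 1 ^ 2) + (b 0 ^ 2 + b 1 ^ 2) + (c 0 ^ 2 + c 1 ^ 2)) := by
  obtain ⟨n1, n2, n3⟩ := ne_of_orient_pos h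
  have s3 (f : Plane → ℝ) : ∑ x ∈ ({a, b, c} : Finset Plane), f x = f a + f b + f c := by
    rw [Finset.sum_insert (by simp [n1, n3]), Finset.sum_insert (by simp [n2]),
      Finset.sum_singleton, add_assoc]
  have t1 : |orient a b c| = orient a b c := abs_of_pos h
  have t2 : |orient b c a| = orient a b c := by rw [orient_rotate, t1]
  have t3 : |orient c a b| = orient a b c := by rw [orient_rotate, t2]
  have t4 : |orient b a c| = orient a b c := by rw [orient_swap, abs_neg, t1]
  have t5 : |orient c b a| = orient a b c := by rw [orient_swap, abs_neg, t2]
  have t6 : |orient a c b| = orient a b c := by rw [orient_swap, abs_neg, t3]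
  simp only [liftVolume, s3, t1, t2, t3, t4, t5, t6, orient_self_left, orient_self_right,
    orient_self_outer, abs_zero]
  ring

lemma BadPair.liftVolume_lt {a b c d o o' : Plane} {ρ ρ' : ℝ} (h : BadPair a b c d o o' ρ ρ') :
    liftVolume {a, b, d} + liftVolume {a, d, c} < liftVolume {a, b, c} + liftVolume {c, b, d} := by
  obtain ⟨h1, h2, h3, h4⟩ := h.convexQuad
  rw [liftVolume_eq h1, liftVolume_eq h2, liftVolume_eq h3, liftVolume_eq h4]
  have h5 := mul_neg_of_neg_of_pos h.power_neg h1
  have ha := circlePower_eq_zero h.ha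
  have hb := circlePower_eq_zero h.hb
  have hc := circlePower_eq_zero h.hc
  rw [circlePower_eq] at ha hb hc h5
  have key : orient a b d * ((a 0 ^ 2 + a 1 ^ 2) + (b 0 ^ 2 + b 1 ^ 2) + (d 0 ^ 2 + d 1 ^ 2)) +
      orient a d c * ((a 0 ^ 2 + a 1 ^ 2) + (d 0 ^ 2 + d 1 ^ 2) + (c 0 ^ 2 + c 1 ^ 2)) -
      orient a b c * ((a 0 ^ 2 + a 1 ^ 2) + (b 0 ^ 2 + b 1 ^ 2) + (c 0 ^ 2 + c 1 ^ 2)) -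
      orient c b d * ((c 0 ^ 2 + c 1 ^ 2) + (b 0 ^ 2 + b 1 ^ 2) + (d 0 ^ 2 + d 1 ^ 2)) =
      ((d 0 - o 0) ^ 2 + (d 1 - o 1) ^ 2 - ρ ^ 2) * orient a b c := by
    have e : ∀ x : Plane, x 0 ^ 2 + x 1 ^ 2 = ((x 0 - o 0) ^ 2 + (x 1 - o 1) ^ 2 - ρ ^ 2) +
      (2 * o 0 * x 0 + 2 * o 1 * x 1 - o 0 ^ 2 - o 1 ^ 2 + ρ ^ 2) := fun x => by ring
    rw [e a, e b, e c, e d, ha, hb, hc]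
    unfold orient; ring
  linarith

section Packing

variable {X : Set Plane} {r R : ℝ}

lemma DelaunaySet.two_mul_le_dist (hX : DelaunaySet 2 X r R) {x y : Plane} (hx : x ∈ X)
    (hy : y ∈ X) (hxy : x ≠ y) : 2 * r ≤ dist x y := by
  by_contra! h
  refine hxy (hX.1 (midpoint ℝ x y) ⟨hx, ?_⟩ ⟨hy, ?_⟩) <;> rw [mem_ball]
  · rw [dist_left_midpoint (𝕜 := ℝ)]; norm_num; linarith
  · rw [dist_right_midpoint (𝕜 := ℝ)]; norm_num; linarith

lemma DelaunaySet.card_mul_le (hr : 0 < r) (hX : DelaunaySet 2 X r R) {Y : Finset Plane}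
    (hY : ∀ y ∈ Y, y ∈ X) {S : Set Plane} (hS : volume S ≠ ⊤) (hYS : ∀ y ∈ Y, ball y r ⊆ S) :
    Y.card * (r ^ 2 * Real.pi) ≤ volume.real S := by
  have h1 : volume.real (⋃ y ∈ Y, ball y r) = ∑ y ∈ Y, volume.real (ball y r) := by
    refine measureReal_biUnion_finset ?_ (fun y _ => measurableSet_ball) ?_
    · intro x hx y hy hxy
      exact ball_disjoint_ball (by linarith [hX.two_mul_le_dist (hY x hx) (hY y hy) hxy])
    · intro y _
      exact measure_ball_lt_top.ne
  have h2 (y : Plane) : volume.real (ball y r) = r ^ 2 * Real.pi := by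
    rw [Measure.real, EuclideanSpace.volume_ball_fin_two]
    simp [hr.le, Real.pi_pos.le]
  simp only [h2, Finset.sum_const, nsmul_eq_mul] at h1
  rw [← h1]
  exact measureReal_mono (Set.iUnion₂_subset hYS) hS

lemma volume_real_closedBall_plane (z : Plane) {a : ℝ} (ha : 0 ≤ a) :
    volume.real (closedBall z a) = a ^ 2 * Real.pi := by
  rw [Measure.real, EuclideanSpace.volume_closedBall_fin_two]
  simp [ha, Real.pi_pos.le]

lemma DelaunaySet.card_le_of_subset_closedBall (hr : 0 < r) (hX : DelaunaySet 2 X r R)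
    {Y : Finset Plane} (hY : ∀ y ∈ Y, y ∈ X) {z : Plane} {a : ℝ} (ha : 0 ≤ a)
    (hYz : ∀ y ∈ Y, dist y z ≤ a) : (Y.card : ℝ) ≤ ((a + r) / r) ^ 2 := by
  have h := hX.card_mul_le hr hY (S := closedBall z (a + r)) measure_closedBall_lt_top.ne
    (fun y hy x hx => by
      rw [mem_ball] at hx
      rw [mem_closedBall]
      linarith [dist_triangle x y z, hYz y hy])
  rw [volume_real_closedBall_plane z (by positivity)] at h
  rw [div_pow, le_div_iff₀ (by positivity)]
  have := Real.pi_pos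
  nlinarith

lemma DelaunaySet.finite_inter (hr : 0 < r) (hX : DelaunaySet 2 X r R) (z : Plane) (a : ℝ) :
    (X ∩ closedBall z a).Finite := by
  by_contra h
  obtain ⟨n, hn⟩ := exists_nat_gt (((max a 0 + r) / r) ^ 2)
  obtain ⟨Y, hY, hYn⟩ := Set.Infinite.exists_subset_card_eq h n
  have := hX.card_le_of_subset_closedBall hr (Y := Y) (z := z) (a := max a 0)
    (fun y hy => (hY hy).1) (le_max_right _ _)
    (fun y hy => (mem_closedBall.1 (hY hy).2).trans (le_max_left _ _))
  rw [hYn] at this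
  linarith

lemma DelaunaySet.countable (hr : 0 < r) (hX : DelaunaySet 2 X r R) : X.Countable := by
  have : X = ⋃ n : ℕ, X ∩ closedBall 0 n := by
    rw [← Set.inter_iUnion, iUnion_closedBall_nat, Set.inter_univ]
  rw [this]
  exact Set.countable_iUnion fun n => (hX.finite_inter hr 0 n).countable

lemma DelaunaySet.finite_finsets (hr : 0 < r) (hX : DelaunaySet 2 X r R) (z : Plane) (a : ℝ) :
    {s : Finset Plane | ∀ x ∈ s, x ∈ X ∧ dist x z ≤ a}.Finite := by
  refine ((hX.finite_inter hr z a).toFinset.powerset).finite_toSet.subset fun s hs => ?_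
  simp only [Finset.coe_powerset, Set.mem_preimage, Set.mem_powerset_iff, Set.Finite.coe_toFinset]
  exact fun x hx => hs x hx

end Packing

/-- The triangles of `𝒯` in the closed ball of radius `α`. -/
def inBall (𝒯 : Set (Finset Plane)) (α : ℝ) : Set (Finset Plane) :=
  {s | s ∈ 𝒯 ∧ (s : Set Plane) ⊆ closedBall 0 α}

section Mesh

variable {X : Set Plane} {r R Q : ℝ} {𝒯 : Set (Finset Plane)}

lemma IsMesh.finite_inBall (hr : 0 < r) (hX : DelaunaySet 2 X r R) (hT : IsMesh X Q 𝒯) (α : ℝ) :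
    (inBall 𝒯 α).Finite :=
  (hX.finite_finsets hr 0 α).subset fun s hs x hx => ⟨hT.sub s hs.1 x hx, hs.2 hx⟩

lemma triple_subset_iff {a b c : Plane} {S : Set Plane} :
    (({a, b, c} : Finset Plane) : Set Plane) ⊆ S ↔ a ∈ S ∧ b ∈ S ∧ c ∈ S := by
  simp [Set.insert_subset_iff]

lemma IsMesh.finsum_flipMesh (hr : 0 < r) (hX : DelaunaySet 2 X r R) (hT : IsMesh X Q 𝒯)
    {a b c d : Plane} (h : ConvexQuad a b c d) (h1 : {a, b, c} ∈ 𝒯) (h2 : {c, b, d} ∈ 𝒯) {α : ℝ}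
    (ha : a ∈ closedBall (0 : Plane) α) (hb : b ∈ closedBall (0 : Plane) α)
    (hc : c ∈ closedBall (0 : Plane) α) (hd : d ∈ closedBall (0 : Plane) α)
    (f : Finset Plane → ℝ) :
    ∑ᶠ s ∈ inBall (flipMesh 𝒯 a b c d) α, f s + (f {a, b, c} + f {c, b, d}) =
      ∑ᶠ s ∈ inBall 𝒯 α, f s + (f {a, b, d} + f {a, d, c}) := by
  set B := inBall 𝒯 α \ {{a, b, c}, {c, b, d}} with hB
  have hBf : B.Finite := (hT.finite_inBall hr hX α).subset Set.sdiff_subset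
  have hcd := (ne_of_orient_pos h.cbd).2.2
  have n1 : ({a, b, c} : Finset Plane) ≠ {c, b, d} := by
    intro he
    have : d ∈ ({a, b, c} : Finset Plane) := he ▸ by simp
    simp only [Finset.mem_insert, Finset.mem_singleton] at this
    have := (ne_of_orient_pos h.abd).2
    tauto
  have n2 : ({a, b, d} : Finset Plane) ≠ {a, d, c} := by
    intro he
    have : c ∈ ({a, b, d} : Finset Plane) := he ▸ by simp
    simp only [Finset.mem_insert, Finset.mem_singleton] at this
    have := (ne_of_orient_pos h.abc).2
    tauto
  have e1 : inBall 𝒯 α = insert {a, b, c} (insert {c, b, d} B) := by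
    ext s
    simp only [hB, Set.mem_insert_iff, Set.mem_sdiff, Set.mem_singleton_iff]
    constructor
    · tauto
    · rintro (rfl | rfl | hs)
      · exact ⟨h1, triple_subset_iff.2 ⟨ha, hb, hc⟩⟩
      · exact ⟨h2, triple_subset_iff.2 ⟨hc, hb, hd⟩⟩
      · exact hs.1
  have e2 : inBall (flipMesh 𝒯 a b c d) α = insert {a, b, d} (insert {a, d, c} B) := by
    ext s
    simp only [hB, inBall, flipMesh, Set.mem_insert_iff, Set.mem_sdiff, Set.mem_singleton_iff,
      Set.mem_ofPred_eq]
    constructor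
    · tauto
    · rintro (rfl | rfl | hs)
      · exact ⟨by simp, triple_subset_iff.2 ⟨ha, hb, hd⟩⟩
      · exact ⟨by simp, triple_subset_iff.2 ⟨ha, hd, hc⟩⟩
      · tauto
  have k1 := hT.abd_notMem (hX.countable hr) h h1
  have k2 := hT.adc_notMem (hX.countable hr) h h2
  rw [e1, e2, finsum_mem_insert _ (by simp [hB, n2, inBall, k1]) (hBf.insert _),
    finsum_mem_insert _ (by simp [hB, inBall, k2]) hBf,
    finsum_mem_insert _ (by simp [hB, n1]) (hBf.insert _),
    finsum_mem_insert _ (by simp [hB]) hBf]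
  ring

lemma exists_minimal_mesh (hr : 0 < r) (hX : DelaunaySet 2 X r R) (hT : IsMesh X Q 𝒯) (α : ℝ)
    (F Φ : Finset Plane → ℝ) :
    ∃ 𝒯', IsMesh X Q 𝒯' ∧ ∑ᶠ s ∈ inBall 𝒯' α, F s ≤ ∑ᶠ s ∈ inBall 𝒯 α, F s ∧
      ∀ 𝒯'', IsMesh X Q 𝒯'' → ∑ᶠ s ∈ inBall 𝒯'' α, F s ≤ ∑ᶠ s ∈ inBall 𝒯' α, F s →
        ∑ᶠ s ∈ inBall 𝒯' α, Φ s ≤ ∑ᶠ s ∈ inBall 𝒯'' α, Φ s := by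
  set 𝒮 := (fun 𝒯' => inBall 𝒯' α) ''
    {𝒯' | IsMesh X Q 𝒯' ∧ ∑ᶠ s ∈ inBall 𝒯' α, F s ≤ ∑ᶠ s ∈ inBall 𝒯 α, F s} with h𝒮
  have hfin : 𝒮.Finite := by
    refine (hX.finite_finsets hr 0 α).finite_subsets.subset ?_
    rintro _ ⟨𝒯', h, rfl⟩ s hs x hx
    exact ⟨h.1.sub s hs.1 x hx, hs.2 hx⟩
  obtain ⟨_, ⟨𝒯', h, rfl⟩, hmin⟩ := Set.exists_min_image 𝒮 (fun B => ∑ᶠ s ∈ B, Φ s) hfin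
    ⟨_, 𝒯, ⟨hT, le_rfl⟩, rfl⟩
  exact ⟨𝒯', h.1, h.2, fun 𝒯'' h1 h2 => hmin _ ⟨𝒯'', ⟨h1, h2.trans h.2⟩, rfl⟩⟩

/-- No two adjacent triangles of `𝒯` in the closed ball of radius `α` violate the local Delaunay
condition. -/
def LocallyDelaunay (𝒯 : Set (Finset Plane)) (Q α : ℝ) : Prop :=
  ∀ a b c d o o' ρ ρ', BadPair a b c d o o' ρ ρ' → ρ ≤ Q → ρ' ≤ Q → {a, b, c} ∈ 𝒯 →
    {c, b, d} ∈ 𝒯 → ¬ (a ∈ closedBall (0 : Plane) α ∧ b ∈ closedBall (0 : Plane) α ∧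
      c ∈ closedBall (0 : Plane) α ∧ d ∈ closedBall (0 : Plane) α)

/-- The functional does not increase under flips towards the Delaunay triangulation. -/
def FlipCondition (F : Finset Plane → ℝ) : Prop :=
  ∀ y : Fin 4 → EuclideanSpace ℝ (Fin 2), Function.Injective y →
    (¬ ∃ c ρ, ∀ i, dist (y i) c = ρ) →
    (openSegment ℝ (y 0) (y 2) ∩ openSegment ℝ (y 1) (y 3)).Nonempty →
    EmptySimplex 2 {y 0, y 1, y 2} (Set.range y) →
    EmptySimplex 2 {y 0, y 2, y 3} (Set.range y) →
    F {y 0, y 1, y 2} + F {y 0, y 2, y 3} ≤ F {y 0, y 1, y 3} + F {y 1, y 2, y 3}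

lemma FlipCondition.le {F : Finset Plane → ℝ} (hF : FlipCondition F) {a b c d o o' : Plane}
    {ρ ρ' : ℝ} (h : BadPair a b c d o o' ρ ρ') :
    F {a, b, d} + F {a, d, c} ≤ F {a, b, c} + F {c, b, d} := by
  obtain ⟨n1, n2, n3⟩ := ne_of_orient_pos h.abc
  obtain ⟨-, n4, n5⟩ := ne_of_orient_pos h.cbd
  have n6 := (ne_of_orient_pos h.orient_abd_pos).2.2
  have hrange : Set.range ![a, b, d, c] = {a, b, d, c} := by
    simp only [Matrix.range_cons, Matrix.range_empty, Set.union_empty, Set.singleton_union]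
  have := hF ![a, b, d, c] ?_ ?_ ?_ ?_ ?_
  · rw [← triple_rotate c b d]
    exact this
  · intro i j hij
    fin_cases i <;> fin_cases j <;> simp_all [eq_comm]
  · rintro ⟨o₁, ρ₁, h1⟩
    have ha : dist a o₁ = ρ₁ := h1 0
    have hb : dist b o₁ = ρ₁ := h1 1
    have hd : dist d o₁ = ρ₁ := h1 2
    have hc : dist c o₁ = ρ₁ := h1 3
    have := h.power_pos_of_abd ha hb hd
    rw [circlePower_eq_zero hc] at this
    exact this.false
  · exact h.diagonals_cross
  · rw [hrange]; exact h.empty_abd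
  · rw [hrange]; exact h.empty_adc

lemma exists_locallyDelaunay_mesh (hr : 0 < r) (hX : DelaunaySet 2 X r R) (hT : IsMesh X Q 𝒯)
    (α : ℝ) {F : Finset Plane → ℝ} (hF : FlipCondition F) :
    ∃ 𝒯', IsMesh X Q 𝒯' ∧ ∑ᶠ s ∈ inBall 𝒯' α, F s ≤ ∑ᶠ s ∈ inBall 𝒯 α, F s ∧
      LocallyDelaunay 𝒯' Q α := by
  obtain ⟨𝒯', hT', hF', hmin⟩ := exists_minimal_mesh hr hX hT α F liftVolume
  refine ⟨𝒯', hT', hF', ?_⟩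
  rintro a b c d o o' ρ ρ' h hρ hρ' h1 h2 ⟨ha, hb, hc, hd⟩
  have s1 := hT'.finsum_flipMesh hr hX h.convexQuad h1 h2 ha hb hc hd F
  have s2 := hT'.finsum_flipMesh hr hX h.convexQuad h1 h2 ha hb hc hd liftVolume
  have := hmin _ (hT'.isMesh_flipMesh (hX.countable hr) h.convexQuad h1 h2
    (h.hasCircumradiusLE_abd hρ hρ') (h.hasCircumradiusLE_adc hρ hρ')) (by linarith [hF.le h])
  linarith [h.liftVolume_lt]

end Mesh

section Uniqueness

variable {X : Set Plane} {r R Q : ℝ} {𝒯 : Set (Finset Plane)}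

lemma mem_convexHull_triple {a b c p : Plane} (h : 0 < orient a b c) (h1 : 0 ≤ orient a b p)
    (h2 : 0 ≤ orient b c p) (h3 : 0 ≤ orient c a p) :
    p ∈ convexHull ℝ (({a, b, c} : Finset Plane) : Set Plane) := by
  have hc := convex_convexHull ℝ (({a, b, c} : Finset Plane) : Set Plane)
  have hs := subset_convexHull ℝ (({a, b, c} : Finset Plane) : Set Plane)
  have hsum := orient_add a b c p
  have := hc.sum_mem (t := Finset.univ)
    (w := ![orient b c p / orient a b c, orient c a p / orient a b c, orient a b p / orient a b c])
    (z := ![a, b, c])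
    (by intro i _; fin_cases i <;> simp <;> positivity)
    (by simp only [Fin.sum_univ_three]; simp; field_simp; linarith)
    (by intro i _; fin_cases i; exacts [hs (by simp), hs (by simp), hs (by simp)])
  convert this using 1
  simp only [Fin.sum_univ_three]
  ext i
  simp
  field_simp
  fin_cases i <;> simp [orient] <;> ring

lemma InTriangle.mem_convexHull {s : Finset Plane} {p : Plane} (h : InTriangle s p) :
    p ∈ convexHull ℝ (s : Set Plane) := by
  obtain ⟨a, b, c, rfl, h1, h2, h3⟩ := h
  exact mem_convexHull_triple (by rw [← orient_add a b c p]; positivity) h1.le h2.le h3.le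

lemma InTriangle.dist_le {s : Finset Plane} {p z : Plane} {k : ℝ} (h : InTriangle s p)
    (hs : ∀ v ∈ s, dist v z ≤ k) : dist p z ≤ k :=
  convexHull_min (fun v hv => mem_closedBall.2 (hs v hv)) (convex_closedBall z k) h.mem_convexHull

lemma Generic.card_le {X : Set Plane} (hX : Generic 2 X) {s : Finset Plane} (hs : ∀ x ∈ s, x ∈ X)
    {o : Plane} {ρ : ℝ} (h : ∀ x ∈ s, dist x o = ρ) : s.card ≤ 3 :=
  hX s hs ⟨o, ρ, h⟩

lemma eq_of_empty_of_inTriangle (hX : Generic 2 X) {s t : Finset Plane} {p : Plane}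
    (hs : ∀ x ∈ s, x ∈ X) (ht : ∀ x ∈ t, x ∈ X) (hs3 : s.card = 3) (ht3 : t.card = 3)
    (hsp : InTriangle s p) (htp : InTriangle t p) {o o' : Plane} {ρ ρ' : ℝ}
    (hso : ∀ x ∈ s, dist x o = ρ) (hto : ∀ x ∈ t, dist x o' = ρ')
    (hse : ∀ x ∈ t, ρ ≤ dist x o) (hte : ∀ x ∈ s, ρ' ≤ dist x o') : s = t := by
  obtain ⟨a, b, c, rfl, h1, h2, h3⟩ := hsp
  obtain ⟨a', b', c', rfl, h1', h2', h3'⟩ := htp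
  simp only [Finset.mem_insert, Finset.mem_singleton, forall_eq_or_imp, forall_eq]
    at hso hto hse hte
  have hρ : 0 ≤ ρ := hso.1 ▸ dist_nonneg
  have hρ' : 0 ≤ ρ' := hto.1 ▸ dist_nonneg
  have e := circlePower_barycentric o o' ρ ρ' a b c p
  have e' := circlePower_barycentric o o' ρ ρ' a' b' c' p
  rw [circlePower_eq_zero hso.1, circlePower_eq_zero hso.2.1, circlePower_eq_zero hso.2.2] at e
  rw [circlePower_eq_zero hto.1, circlePower_eq_zero hto.2.1, circlePower_eq_zero hto.2.2] at e'
  have ka := (circlePower_nonneg_iff hρ').2 hte.1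
  have kb := (circlePower_nonneg_iff hρ').2 hte.2.1
  have kc := (circlePower_nonneg_iff hρ').2 hte.2.2
  have ka' := (circlePower_nonneg_iff hρ).2 hse.1
  have kb' := (circlePower_nonneg_iff hρ).2 hse.2.1
  have kc' := (circlePower_nonneg_iff hρ).2 hse.2.2
  have hpos' : 0 < orient a' b' c' := by rw [← orient_add a' b' c' p]; positivity
  have hpos : 0 < orient a b c := by rw [← orient_add a b c p]; positivity
  have hle : 0 ≤ circlePower o ρ p - circlePower o' ρ' p :=
    nonneg_of_mul_nonneg_left (e' ▸ by simp only [sub_zero]; positivity) hpos'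
  have m0 := mul_nonneg hle hpos.le
  have ma := mul_nonneg ka h2.le
  have mb := mul_nonneg kb h3.le
  have mc := mul_nonneg kc h1.le
  have za : circlePower o' ρ' a = 0 :=
    (mul_eq_zero.1 (by linarith : circlePower o' ρ' a * orient b c p = 0)).resolve_right h2.ne'
  have zb : circlePower o' ρ' b = 0 :=
    (mul_eq_zero.1 (by linarith : circlePower o' ρ' b * orient c a p = 0)).resolve_right h3.ne'
  have zc : circlePower o' ρ' c = 0 :=
    (mul_eq_zero.1 (by linarith : circlePower o' ρ' c * orient a b p = 0)).resolve_right h1.ne'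
  have hcard := hX.card_le (s := {a, b, c} ∪ {a', b', c'}) (o := o') (ρ := ρ')
    (by intro x hx; exact (Finset.mem_union.1 hx).elim (hs x) (ht x))
    (by
      intro x hx
      simp only [Finset.mem_union, Finset.mem_insert, Finset.mem_singleton] at hx
      rcases hx with (rfl | rfl | rfl) | (rfl | rfl | rfl)
      · exact dist_eq_of_circlePower hρ' za
      · exact dist_eq_of_circlePower hρ' zb
      · exact dist_eq_of_circlePower hρ' zc
      · exact hto.1
      · exact hto.2.1
      · exact hto.2.2)
  have u1 := Finset.eq_of_subset_of_card_le
    (Finset.subset_union_left (s₁ := {a, b, c}) (s₂ := {a', b', c'})) (by omega)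
  have u2 := Finset.eq_of_subset_of_card_le
    (Finset.subset_union_right (s₁ := {a, b, c}) (s₂ := {a', b', c'})) (by omega)
  exact u1.trans u2.symm

lemma IsMesh.card (hT : IsMesh X Q 𝒯) {s : Finset Plane} (hs : s ∈ 𝒯) : s.card = 3 := by
  obtain ⟨a, b, c, rfl, h⟩ := hT.tri s hs
  obtain ⟨h1, h2, h3⟩ := ne_of_orient_pos h
  exact Finset.card_eq_three.2 ⟨a, b, c, h1, h3, h2, rfl⟩

lemma IsMesh.exists_edge (hT : IsMesh X Q 𝒯) {s : Finset Plane} (hs : s ∈ 𝒯) {x : Plane}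
    (hx : x ∈ X) (hxs : x ∉ s) :
    ∃ a b c, s = {a, b, c} ∧ 0 < orient a b c ∧ orient b c x < 0 := by
  obtain ⟨a, b, c, rfl, h⟩ := hT.tri s hs
  by_contra! hn
  have h1 := hn a b c rfl h
  have h2 := hn b c a (triple_rotate a b c).symm (by rwa [orient_rotate])
  have h3 := hn c a b (triple_rotate c a b)
    (by rwa [← orient_rotate c a b])
  have := hT.vert a b c hs h x hx h3 h1 h2
  simp only [Finset.mem_insert, Finset.mem_singleton] at hxs
  tauto

lemma LocallyDelaunay.empty (hr : 0 < r) (hX : DelaunaySet 2 X r R) (hgen : Generic 2 X)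
    (hT : IsMesh X Q 𝒯) {α : ℝ} (hloc : LocallyDelaunay 𝒯 Q α) {o : Finset Plane → Plane}
    {ρ : Finset Plane → ℝ} (hρ : ∀ s ∈ 𝒯, ρ s ≤ Q) (hso : ∀ s ∈ 𝒯, ∀ v ∈ s, dist v (o s) = ρ s)
    {x : Plane} (hx : x ∈ X) (hxα : dist x 0 ≤ α - 4 * Q) : ∀ s ∈ 𝒯, ρ s ≤ dist x (o s) := by
  by_contra! hne
  have hpos : ∀ s ∈ 𝒯, 0 ≤ ρ s := fun s hs => by
    obtain ⟨a, b, c, rfl, h⟩ := hT.tri s hs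
    rw [← hso _ hs a (by simp)]; exact dist_nonneg
  have hfin : {s | s ∈ 𝒯 ∧ dist x (o s) < ρ s}.Finite := by
    refine (hX.finite_finsets hr x (2 * Q)).subset ?_
    rintro s ⟨hs, hsx⟩ v hv
    refine ⟨hT.sub s hs v hv, ?_⟩
    have := dist_triangle_right v x (o s)
    linarith [hso s hs v hv, hρ s hs]
  obtain ⟨s, ⟨hs, hsx⟩, hmin⟩ := Set.exists_min_image _
    (fun s => circlePower (o s) (ρ s) x) hfin hne
  have hxs : x ∉ s := fun h => hsx.ne (hso s hs x h)
  obtain ⟨a, b, c, hsabc, h, hbc⟩ := hT.exists_edge hs hx hxs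
  obtain ⟨d, ht, h'⟩ := hT.nbr a b c (hsabc ▸ hs) h
  rw [← triple_rotate d c b] at ht
  rw [← orient_rotate d c b] at h'
  set t : Finset Plane := {c, b, d} with ht_def
  have ha := hso s hs a (by simp [hsabc])
  have hb := hso s hs b (by simp [hsabc])
  have hc := hso s hs c (by simp [hsabc])
  have hb' := hso t ht b (by simp [ht_def])
  have hc' := hso t ht c (by simp [ht_def])
  have hd' := hso t ht d (by simp [ht_def])
  have near : ∀ v, dist v (o s) = ρ s → dist v 0 ≤ α - 2 * Q := fun v hv => by
    have h1 := dist_triangle v x 0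
    have h2 := dist_triangle_right v x (o s)
    linarith [hρ s hs]
  have hQ : 0 ≤ Q := (hpos s hs).trans (hρ s hs)
  have hdα : dist d 0 ≤ α := by
    have h1 := dist_triangle d b 0
    have h2 := dist_triangle_right d b (o t)
    linarith [hρ t ht, near b hb]
  have hd : 0 < circlePower (o s) (ρ s) d := by
    by_contra! hd
    rcases hd.lt_or_eq with hd | hd
    · refine hloc a b c d (o s) (o t) (ρ s) (ρ t)
        ⟨h, h', ha, hb, hc, hc', hb', hd', (circlePower_neg_iff (hpos s hs)).1 hd⟩
        (hρ s hs) (hρ t ht)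
        (hsabc ▸ hs) ht ⟨?_, ?_, ?_, hdα⟩
      · exact mem_closedBall.2 (by linarith [near a ha])
      · exact mem_closedBall.2 (by linarith [near b hb])
      · exact mem_closedBall.2 (by linarith [near c hc])
    · have hd := dist_eq_of_circlePower (hpos s hs) hd
      have hcard := hgen.card_le (s := insert d s) (o := o s) (ρ := ρ s)
        (by
          intro v hv
          rcases Finset.mem_insert.1 hv with rfl | hv
          · exact hT.sub t ht v (by simp [ht_def])
          · exact hT.sub s hs v hv)
        (by
          intro v hv
          rcases Finset.mem_insert.1 hv with rfl | hv
          · exact hd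
          · exact hso s hs v hv)
      have hds : d ∉ s := by
        rw [hsabc]
        simp only [Finset.mem_insert, Finset.mem_singleton]
        rintro (rfl | rfl | rfl)
        · rw [orient_swap, orient_rotate] at h'; linarith
        · simp [orient_self_right] at h'
        · simp [orient_self_outer] at h'
      rw [Finset.card_insert_of_notMem hds, hT.card hs] at hcard
      omega
  have e := circlePower_barycentric (o s) (o t) (ρ s) (ρ t) c b d x
  rw [circlePower_eq_zero hb, circlePower_eq_zero hc, circlePower_eq_zero hb',
    circlePower_eq_zero hc', circlePower_eq_zero hd'] at e
  have hcb : 0 < orient c b x := by rw [orient_swap]; linarith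
  have hlt : circlePower (o t) (ρ t) x < circlePower (o s) (ρ s) x := by
    by_contra! hge
    have k1 := mul_pos hd hcb
    have k2 := mul_nonneg (sub_nonneg.2 hge) h'.le
    linarith
  have hsx' := (circlePower_neg_iff (hpos s hs)).2 hsx
  have := hmin t ⟨ht, (circlePower_neg_iff (hpos t ht)).1 (hlt.trans hsx')⟩
  linarith

/-- A mesh that is locally Delaunay in a ball agrees with a Delaunay mesh deep inside the ball. -/
lemma LocallyDelaunay.inBall_eq (hr : 0 < r) (hX : DelaunaySet 2 X r R) (hgen : Generic 2 X)
    (hT : IsMesh X Q 𝒯) {α : ℝ} (hloc : LocallyDelaunay 𝒯 Q α) {𝒟 : Set (Finset Plane)}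
    (hD : IsMesh X Q 𝒟) (hDe : ∀ s ∈ 𝒟, EmptySimplex 2 s X) :
    inBall 𝒯 (α - 8 * Q) = inBall 𝒟 (α - 8 * Q) := by
  choose! o ρ hρ hso using hT.rad
  have hpos : ∀ s ∈ 𝒯, 0 ≤ ρ s := fun s hs => by
    obtain ⟨a, b, c, rfl, h⟩ := hT.tri s hs
    rw [← hso _ hs a (by simp)]; exact dist_nonneg
  have key : ∀ s ∈ 𝒯, ∀ t ∈ 𝒟, ∀ p, InTriangle s p → InTriangle t p → dist p 0 ≤ α - 8 * Q →
      s = t := by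
    intro s hs t ht p hsp htp hp
    obtain ⟨o', ρ', hto, hte⟩ := hDe t ht
    refine eq_of_empty_of_inTriangle hgen (hT.sub s hs) (hD.sub t ht) (hT.card hs) (hD.card ht)
      hsp htp (hso s hs) hto ?_ (fun x hx => hte x (hT.sub s hs x hx))
    intro x hx
    by_contra! hlt
    have h1 : dist p (o s) ≤ ρ s := hsp.dist_le fun v hv => (hso s hs v hv).le
    have h2 := dist_triangle x p 0
    have h3 := dist_triangle_right x p (o s)
    refine hlt.not_ge (hloc.empty hr hX hgen hT hρ hso (hD.sub t ht x hx) ?_ s hs)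
    linarith [hρ s hs, (hpos s hs).trans (hρ s hs)]
  ext s
  constructor
  · rintro ⟨hs, hsα⟩
    obtain ⟨a, b, c, rfl, h⟩ := hT.tri s hs
    obtain ⟨p, hp, hsp⟩ := exists_offLines_inTriangle' (hX.countable hr) h
    obtain ⟨t, ⟨ht, htp⟩, -⟩ := hD.cov p hp
    have hk := key _ hs t ht p hsp htp (hsp.dist_le fun v hv => hsα hv)
    exact ⟨hk ▸ ht, hsα⟩
  · rintro ⟨ht, htα⟩
    obtain ⟨a, b, c, rfl, h⟩ := hD.tri s ht
    obtain ⟨p, hp, htp⟩ := exists_offLines_inTriangle' (hX.countable hr) h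
    obtain ⟨s, ⟨hs, hsp⟩, -⟩ := hT.cov p hp
    have hk := key s hs _ ht p hsp htp (htp.dist_le fun v hv => htα hv)
    exact ⟨hk ▸ hs, htα⟩

end Uniqueness

section Complexes

variable {X : Set Plane} {r R Q : ℝ} {T : Geometry.SimplicialComplex ℝ Plane}

lemma convex_orient_nonneg (a b : Plane) : Convex ℝ {p | 0 ≤ orient a b p} := by
  intro x hx y hy s t hs ht hst
  have : orient a b (s • x + t • y) = s * orient a b x + t * orient a b y := by
    obtain rfl : t = 1 - s := by linarith
    simp [orient]; ring
  simp only [Set.mem_ofPred_eq] at hx hy ⊢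
  rw [this]
  positivity

lemma orient_nonneg_of_mem_convexHull {a b p : Plane} {s : Finset Plane}
    (hs : ∀ v ∈ s, 0 ≤ orient a b v) (hp : p ∈ convexHull ℝ (s : Set Plane)) :
    0 ≤ orient a b p :=
  convexHull_min (fun v hv => hs v hv) (convex_orient_nonneg a b) hp

lemma orient_nonneg_of_mem_triple {a b c p : Plane} (h : 0 < orient a b c)
    (hp : p ∈ convexHull ℝ (({a, b, c} : Finset Plane) : Set Plane)) : 0 ≤ orient a b p := by
  refine orient_nonneg_of_mem_convexHull ?_ hp
  simp [orient_self_right, orient_self_outer, h.le]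

lemma DelaunaySet.exists_ne (hX : DelaunaySet 2 X r R) (a : Plane) : ∃ b ∈ X, a ≠ b := by
  obtain ⟨z, hz⟩ := NormedSpace.exists_lt_norm ℝ Plane R
  obtain ⟨b, hb, hbz⟩ := hX.2 (a + z)
  refine ⟨b, hb, ?_⟩
  rintro rfl
  rw [mem_closedBall, dist_self_add_right] at hbz
  linarith

lemma DelaunaySet.notMem_convexHull (hX : DelaunaySet 2 X r R) {s : Finset Plane}
    (hs : ∀ v ∈ s, v ∈ X) (hcard : s.card ≤ 2) {p : Plane} (hp : p ∈ offLines X) :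
    p ∉ convexHull ℝ (s : Set Plane) := by
  intro hps
  have key : ∀ a ∈ X, ∀ b ∈ X, a ≠ b → s ⊆ {a, b} → False := by
    intro a ha b hb hab hsab
    have h1 : 0 ≤ orient a b p := orient_nonneg_of_mem_convexHull (fun v hv => by
      have := hsab hv
      simp only [Finset.mem_insert, Finset.mem_singleton] at this
      rcases this with rfl | rfl <;> simp [orient_self_right, orient_self_outer]) hps
    have h2 : 0 ≤ orient b a p := orient_nonneg_of_mem_convexHull (fun v hv => by
      have := hsab hv
      simp only [Finset.mem_insert, Finset.mem_singleton] at this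
      rcases this with rfl | rfl <;> simp [orient_self_right, orient_self_outer]) hps
    rw [orient_swap] at h2
    exact hp a ha b hb hab (by linarith)
  rcases s.eq_empty_or_nonempty with rfl | ⟨a, ha⟩
  · simp at hps
  by_cases hb : ∃ b ∈ s, a ≠ b
  · obtain ⟨b, hb, hab⟩ := hb
    refine key a (hs a ha) b (hs b hb) hab ?_
    have := Finset.eq_of_subset_of_card_le (s := {a, b}) (t := s)
      (by simp [Finset.insert_subset_iff, ha, hb]) (by rwa [Finset.card_pair hab])
    exact this ▸ Finset.Subset.refl _
  · push Not at hb
    obtain ⟨b, hbX, hab⟩ := hX.exists_ne a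
    exact key a (hs a ha) b hbX hab fun v hv => by simp [← hb v hv]

lemma exists_orient_pos {s : Finset Plane} (hs : AffineIndependent ℝ ((↑) : s → Plane))
    (h3 : s.card = 3) : ∃ a b c, s = {a, b, c} ∧ 0 < orient a b c := by
  obtain ⟨a, b, c, hab, hac, hbc, rfl⟩ := Finset.card_eq_three.1 h3
  have hne : orient a b c ≠ 0 := by
    intro h0
    have hind : AffineIndependent ℝ ![a, b, c] := by
      have := hs.comp_embedding ⟨![⟨a, by simp⟩, ⟨b, by simp⟩, ⟨c, by simp⟩], by
        intro i j hij
        fin_cases i <;> fin_cases j <;> simp_all⟩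
      convert this using 1
      ext i
      fin_cases i <;> rfl
    rw [affineIndependent_iff_not_collinear_set] at hind
    refine hind ((collinear_iff_of_mem (p₀ := a) (by simp)).2 ⟨b - a, ?_⟩)
    have hd : (b 0 - a 0) ^ 2 + (b 1 - a 1) ^ 2 ≠ 0 := by
      rw [← plane_dist_sq]
      exact pow_ne_zero _ (dist_ne_zero.2 hab.symm)
    simp only [Set.mem_insert_iff, Set.mem_singleton_iff, forall_eq_or_imp, forall_eq]
    refine ⟨⟨0, by simp⟩, ⟨1, by simp⟩,
      ⟨((c 0 - a 0) * (b 0 - a 0) + (c 1 - a 1) * (b 1 - a 1)) /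
        ((b 0 - a 0) ^ 2 + (b 1 - a 1) ^ 2), ?_⟩⟩
    unfold orient at h0
    ext i
    fin_cases i
    · simp
      field_simp
      linear_combination (- (b 1 - a 1)) * h0
    · simp
      field_simp
      linear_combination (b 0 - a 0) * h0
  rcases hne.lt_or_gt with h | h
  · exact ⟨b, a, c, (triple_swap a b c).symm, by rw [orient_swap]; linarith⟩
  · exact ⟨a, b, c, rfl, h⟩

lemma HasCircumradiusLE.mono {d : ℕ} {s : Finset (EuclideanSpace ℝ (Fin d))} {q q' : ℝ}
    (h : HasCircumradiusLE d s q) (hq : q ≤ q') : HasCircumradiusLE d s q' := by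
  obtain ⟨c, ρ, hρ, hc⟩ := h
  exact ⟨c, ρ, hρ.trans hq, hc⟩

lemma EmptySimplex.hasCircumradiusLE {d : ℕ} {s : Finset (EuclideanSpace ℝ (Fin d))}
    {X : Set (EuclideanSpace ℝ (Fin d))} (h : EmptySimplex d s X) (hX : DelaunaySet d X r R) :
    HasCircumradiusLE d s R := by
  obtain ⟨c, ρ, hc, he⟩ := h
  obtain ⟨x, hx, hxc⟩ := hX.2 c
  exact ⟨c, ρ, (he x hx).trans hxc, hc⟩

lemma IsTriangulationOf.mem (hT : IsTriangulationOf 2 T X) {s : Finset Plane} (hs : s ∈ T.faces) :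
    ∀ x ∈ s, x ∈ X := by
  intro x hx
  rw [← hT.1]
  exact T.down_closed hs (Finset.singleton_subset_iff.2 hx) (Finset.singleton_nonempty x)

lemma IsTriangulationOf.exists_face (hX : DelaunaySet 2 X r R) (hT : IsTriangulationOf 2 T X)
    {p : Plane} (hp : p ∈ offLines X) :
    ∃ s ∈ T.faces, s.card = 3 ∧ p ∈ convexHull ℝ (s : Set Plane) := by
  have hps : p ∈ T.space := by rw [hT.2]; trivial
  obtain ⟨s, hs, hps⟩ := Geometry.SimplicialComplex.mem_space_iff.1 hps
  refine ⟨s, hs, le_antisymm ?_ ?_, hps⟩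
  · have := (T.indep hs).card_le_finrank_succ
    have h2 := Submodule.finrank_le (vectorSpan ℝ (Set.range ((↑) : s → Plane)))
    rw [finrank_euclideanSpace_fin] at h2
    rw [Fintype.card_coe] at this
    omega
  · by_contra! hlt
    exact hX.notMem_convexHull (hT.mem hs) (by omega) hp hps

lemma inTriangle_of_mem_convexHull {s : Finset Plane} {p : Plane} {a b c : Plane}
    (hs : s = {a, b, c}) (h : 0 < orient a b c) (hsX : ∀ x ∈ s, x ∈ X) (hp : p ∈ offLines X)
    (hps : p ∈ convexHull ℝ (s : Set Plane)) : InTriangle s p := by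
  subst hs
  obtain ⟨h1, h2, h3⟩ := ne_of_orient_pos h
  have ha := hsX a (by simp)
  have hb := hsX b (by simp)
  have hc := hsX c (by simp)
  refine ⟨a, b, c, rfl, ?_, ?_, ?_⟩
  · exact (orient_nonneg_of_mem_triple h hps).lt_of_ne' (hp a ha b hb h1)
  · rw [← triple_rotate] at hps
    rw [← orient_rotate] at h
    exact (orient_nonneg_of_mem_triple h hps).lt_of_ne' (hp b hb c hc h2)
  · rw [triple_rotate c a b] at hps
    rw [orient_rotate c a b] at h
    exact (orient_nonneg_of_mem_triple h hps).lt_of_ne' (hp c hc a ha h3.symm)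

lemma IsTriangulationOf.exists_adjacent (hr : 0 < r) (hX : DelaunaySet 2 X r R)
    (hT : IsTriangulationOf 2 T X) (hQ : UniformlyBounded 2 T Q) {e : Finset Plane} {v w : Plane}
    (he : e ∈ T.faces) (heq : e = {v, w}) (hvw : v ≠ w) :
    ∃ z, ({z, w, v} : Finset Plane) ∈ T.faces ∧ 0 < orient z w v := by
  set m : Plane := midpoint ℝ w v with hm
  have hm0 : orient w v m = 0 := by
    rw [hm, midpoint_eq_smul_add]; simp [orient]; ring
  have hmc : m ∈ closure ({x | 0 < orient w v x} ∩ offLines X) := by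
    have h1 := mem_closure_orient_pos hvw.symm hm0
    exact closure_minimal ((dense_offLines (hX.countable hr)).open_subset_closure_inter
      (isOpen_orient_pos w v)) isClosed_closure h1
  have hfreq := (mem_closure_iff_frequently.1 hmc).and_eventually (ball_mem_nhds m one_pos)
  have hfreq' : ∃ᶠ p in nhds m,
      ∃ s ∈ {s : Finset Plane | ∀ x ∈ s, x ∈ X ∧ dist x m ≤ 2 * Q + 1},
        s ∈ T.faces ∧ s.card = 3 ∧ p ∈ convexHull ℝ (s : Set Plane) ∧ 0 < orient w v p := by
    refine hfreq.mono ?_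
    rintro p ⟨⟨hpo, hp⟩, hpm⟩
    obtain ⟨s, hs, hs3, hps⟩ := hT.exists_face hX hp
    obtain ⟨o, ρ, hρ, ho⟩ := hQ s hs hs3
    refine ⟨s, fun x hx => ⟨hT.mem hs x hx, ?_⟩, hs, hs3, hps, hpo⟩
    have h1 : dist p o ≤ ρ :=
      convexHull_min (fun v hv => mem_closedBall.2 (ho v hv).le) (convex_closedBall o ρ) hps
    have h2 := dist_triangle x o m
    have h3 := dist_triangle_left o m p
    have h4 := mem_ball.1 hpm
    linarith [ho x hx]
  obtain ⟨s, -, hs⟩ := (frequently_exists_finite (hX.finite_finsets hr m (2 * Q + 1))).1 hfreq'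
  obtain ⟨-, hsT, hs3, -⟩ := hs.exists
  have hms : m ∈ convexHull ℝ (s : Set Plane) := by
    have hcl : IsClosed (convexHull ℝ (s : Set Plane)) := s.finite_toSet.isClosed_convexHull ℝ
    rw [← hcl.closure_eq]
    exact mem_closure_iff_frequently.2 (hs.mono fun p hp => hp.2.2.1)
  have hme : m ∈ convexHull ℝ (e : Set Plane) := by
    have : m ∈ segment ℝ w v := midpoint_mem_segment w v
    rw [← convexHull_pair] at this
    rw [heq]
    simpa [Set.pair_comm] using this
  have hmi := T.inter_subset_convexHull hsT he ⟨hms, hme⟩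
  have hmem : ∀ u ∈ e, u ∈ s := by
    intro u hu
    by_contra hus
    obtain ⟨u', hu', hsub⟩ : ∃ u', u' ≠ m ∧ (s ∩ e : Set Plane) ⊆ {u'} := by
      have hmv : v ≠ m ∧ w ≠ m := by
        simp [hm, hvw.symm]
      rw [heq] at hu ⊢
      simp only [Finset.mem_insert, Finset.mem_singleton] at hu
      rcases hu with rfl | rfl
      · refine ⟨w, hmv.2, ?_⟩
        rintro x ⟨hxs, hx⟩
        simp at hx ⊢
        exact hx.resolve_left (by rintro rfl; exact hus hxs)
      · refine ⟨v, hmv.1, ?_⟩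
        rintro x ⟨hxs, hx⟩
        simp at hx ⊢
        exact hx.resolve_right (by rintro rfl; exact hus hxs)
    have := convexHull_mono hsub hmi
    rw [convexHull_singleton] at this
    exact hu' this.symm
  have hvs := hmem v (by simp [heq])
  have hws := hmem w (by simp [heq])
  obtain ⟨z, hz, hzpos⟩ : ∃ z ∈ s, 0 < orient w v z := by
    by_contra! hle
    obtain ⟨p, -, -, hps, hpo⟩ := hs.exists
    have := orient_nonneg_of_mem_convexHull (a := v) (b := w) (fun x hx => by
      rw [orient_swap]; linarith [hle x hx]) hps
    rw [orient_swap] at this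
    linarith
  obtain ⟨n1, n2, n3⟩ := ne_of_orient_pos hzpos
  refine ⟨z, ?_, by rwa [← orient_rotate]⟩
  have hse : ({z, w, v} : Finset Plane) = s := by
    refine Finset.eq_of_subset_of_card_le (by simp [Finset.insert_subset_iff, hz, hvs, hws]) ?_
    rw [hs3, Finset.card_eq_three.2 ⟨z, w, v, n3.symm, n2.symm, n1, rfl⟩]
  rwa [hse]

lemma IsTriangulationOf.isMesh (hr : 0 < r) (hX : DelaunaySet 2 X r R)
    (hT : IsTriangulationOf 2 T X) (hQ : UniformlyBounded 2 T Q) :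
    IsMesh X Q {s | s ∈ T.faces ∧ s.card = 3} where
  tri := fun s hs => exists_orient_pos (T.indep hs.1) hs.2
  sub := fun s hs => hT.mem hs.1
  rad := fun s hs => hQ s hs.1 hs.2
  vert := by
    intro a b c hs h x hx h1 h2 h3
    have hxs := mem_convexHull_triple h h1 h2 h3
    have hxT : {x} ∈ T.faces := by rw [← hT.1] at hx; exact hx
    have hxx : x ∈ convexHull ℝ (({x} : Finset Plane) : Set Plane) := by simp
    have := T.inter_subset_convexHull hs.1 hxT ⟨hxs, hxx⟩
    obtain ⟨y, hy, hyx⟩ := convexHull_nonempty_iff.1 ⟨x, this⟩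
    obtain rfl : y = x := by simpa using hyx
    simpa using hy
  nbr := by
    intro u v w hs h
    obtain ⟨n1, n2, n3⟩ := ne_of_orient_pos h
    have he : ({v, w} : Finset Plane) ∈ T.faces :=
      T.down_closed hs.1 (Finset.subset_insert _ _) (by simp)
    obtain ⟨z, hz, hzpos⟩ := hT.exists_adjacent hr hX hQ he rfl n2
    obtain ⟨n1, n2, n3⟩ := ne_of_orient_pos hzpos
    exact ⟨z, ⟨hz, Finset.card_eq_three.2 ⟨z, w, v, n1, n3, n2, rfl⟩⟩, hzpos⟩
  cov := by
    intro p hp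
    obtain ⟨s, hs, hs3, hps⟩ := hT.exists_face hX hp
    obtain ⟨a, b, c, habc, h⟩ := exists_orient_pos (T.indep hs) hs3
    refine ⟨s, ⟨⟨hs, hs3⟩, inTriangle_of_mem_convexHull habc h (hT.mem hs) hp hps⟩, ?_⟩
    rintro t ⟨⟨ht, ht3⟩, htp⟩
    by_contra hne
    have hpi := T.inter_subset_convexHull ht hs ⟨htp.mem_convexHull, hps⟩
    rw [← Finset.coe_inter] at hpi
    refine hX.notMem_convexHull (fun v hv => hT.mem hs v (Finset.mem_inter.1 hv).2) ?_ hp hpi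
    by_contra! hlt
    have h1 := Finset.eq_of_subset_of_card_le
      (Finset.inter_subset_left (s₁ := t) (s₂ := s)) (by omega)
    have h2 := Finset.eq_of_subset_of_card_le
      (Finset.inter_subset_right (s₁ := t) (s₂ := s)) (by omega)
    exact hne (h1.symm.trans h2)

end Complexes

section Density

variable {X : Set Plane} {r R Q : ℝ} {𝒯 𝒟 : Set (Finset Plane)}

lemma card_le_of_meets (hr : 0 < r) (hX : DelaunaySet 2 X r R) (hQ : 0 ≤ Q)
    {𝒢 : Finset (Finset Plane)} {Y : Finset Plane} (hsub : ∀ s ∈ 𝒢, ∀ x ∈ s, x ∈ X)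
    (hrad : ∀ s ∈ 𝒢, HasCircumradiusLE 2 s Q) (hY : ∀ s ∈ 𝒢, ∃ y ∈ Y, y ∈ s) :
    𝒢.card ≤ Y.card * 2 ^ ⌊((2 * Q + r) / r) ^ 2⌋₊ := by
  have h1 : 𝒢 ⊆ Y.biUnion fun y => (hX.finite_inter hr y (2 * Q)).toFinset.powerset := by
    intro s hs
    obtain ⟨y, hy, hys⟩ := hY s hs
    obtain ⟨o, ρ, hρ, ho⟩ := hrad s hs
    refine Finset.mem_biUnion.2 ⟨y, hy, Finset.mem_powerset.2 fun x hx => ?_⟩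
    rw [Set.Finite.mem_toFinset]
    refine ⟨hsub s hs x hx, ?_⟩
    rw [mem_closedBall]
    have := dist_triangle_right x y o
    linarith [ho x hx, ho y hys]
  refine (Finset.card_le_card h1).trans (Finset.card_biUnion_le_card_mul _ _ _ fun y _ => ?_)
  rw [Finset.card_powerset]
  refine Nat.pow_le_pow_right two_pos (Nat.le_floor ?_)
  refine hX.card_le_of_subset_closedBall hr (z := y) ?_ (by positivity) ?_
  · intro x hx
    exact ((Set.Finite.mem_toFinset _).1 hx).1
  · intro x hx
    exact ((Set.Finite.mem_toFinset _).1 hx).2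

lemma DelaunaySet.card_mul_le_annulus (hr : 0 < r) (hX : DelaunaySet 2 X r R) {Y : Finset Plane}
    (hY : ∀ y ∈ Y, y ∈ X) {α β : ℝ} (hβ : r ≤ β) (hβα : β ≤ α)
    (hYα : ∀ y ∈ Y, β ≤ dist y 0 ∧ dist y 0 ≤ α) :
    Y.card * r ^ 2 ≤ (α + r) ^ 2 - (β - r) ^ 2 := by
  have hsub : closedBall (0 : Plane) (β - r) ⊆ closedBall 0 (α + r) :=
    closedBall_subset_closedBall (by linarith)
  have h := hX.card_mul_le hr hY (S := closedBall 0 (α + r) \ closedBall 0 (β - r))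
    (((measure_mono Set.sdiff_subset).trans_lt measure_closedBall_lt_top).ne) (by
      intro y hy z hz
      have h1 := dist_triangle z y 0
      have h2 := dist_triangle_left y 0 z
      have h3 := mem_ball.1 hz
      obtain ⟨h4, h5⟩ := hYα y hy
      refine ⟨mem_closedBall.2 (by linarith), fun h6 => ?_⟩
      rw [mem_closedBall] at h6
      linarith)
  rw [measureReal_sdiff hsub measurableSet_closedBall
    measure_closedBall_lt_top.ne, volume_real_closedBall_plane _ (by linarith),
    volume_real_closedBall_plane _ (by linarith)] at h
  refine le_of_mul_le_mul_right ?_ Real.pi_pos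
  linarith

/-- Meshes that agree away from the boundary of a large ball have sums differing by a boundary
term. -/
lemma sum_inBall_le_add (hr : 0 < r) (hX : DelaunaySet 2 X r R) (hQ : 0 ≤ Q) (h𝒯 : IsMesh X Q 𝒯)
    (h𝒟 : IsMesh X Q 𝒟) {F : Finset Plane → ℝ} {B : ℝ} (hB : 0 ≤ B) (hF𝒯 : ∀ s ∈ 𝒯, |F s| ≤ B)
    (hF𝒟 : ∀ s ∈ 𝒟, |F s| ≤ B) {α k : ℝ} (hk : 0 ≤ k) (hα : k + r ≤ α)
    (heq : inBall 𝒯 (α - k) = inBall 𝒟 (α - k)) :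
    ∑ᶠ s ∈ inBall 𝒟 α, F s ≤ ∑ᶠ s ∈ inBall 𝒯 α, F s +
      B * (2 ^ ⌊((2 * Q + r) / r) ^ 2⌋₊ * (4 * (k + 2 * r) / r ^ 2)) * α := by
  set M : ℝ := 2 ^ ⌊((2 * Q + r) / r) ^ 2⌋₊ with hM
  set G := (h𝒟.finite_inBall hr hX α).toFinset with hG
  set H := (h𝒯.finite_inBall hr hX α).toFinset with hH
  rw [finsum_mem_eq_finite_toFinset_sum _ (h𝒟.finite_inBall hr hX α),
    finsum_mem_eq_finite_toFinset_sum _ (h𝒯.finite_inBall hr hX α), ← hG, ← hH]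
  set Y := (hX.finite_inter hr 0 α).toFinset.filter fun y => α - k ≤ dist y 0 with hYdef
  have hY : (Y.card : ℝ) ≤ 2 * (k + 2 * r) / r ^ 2 * α := by
    have := hX.card_mul_le_annulus hr (Y := Y) (α := α) (β := α - k) ?_ (by linarith)
      (by linarith) ?_
    · rw [div_mul_eq_mul_div, le_div_iff₀ (by positivity)]
      nlinarith
    · intro y hy
      exact ((Set.Finite.mem_toFinset _).1 (Finset.mem_filter.1 hy).1).1
    · intro y hy
      obtain ⟨h1, h2⟩ := Finset.mem_filter.1 hy
      exact ⟨h2, ((Set.Finite.mem_toFinset _).1 h1).2⟩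
  have bound : ∀ 𝒮 : Set (Finset Plane), IsMesh X Q 𝒮 → (∀ s ∈ 𝒮, |F s| ≤ B) →
      ∀ G : Finset (Finset Plane), (∀ s ∈ G, s ∈ inBall 𝒮 α ∧ s ∉ inBall 𝒮 (α - k)) →
      |∑ s ∈ G, F s| ≤ B * (M * (2 * (k + 2 * r) / r ^ 2 * α)) := by
    intro 𝒮 h𝒮 hF G hG
    have hcard : (G.card : ℝ) ≤ Y.card * M := by
      refine (Nat.cast_le.2 (card_le_of_meets hr hX hQ (fun s hs => h𝒮.sub s (hG s hs).1.1)
        (fun s hs => h𝒮.rad s (hG s hs).1.1) (Y := Y) fun s hs => ?_)).trans_eq (by push_cast; rfl)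
      obtain ⟨⟨hs1, hs2⟩, hs3⟩ := hG s hs
      have : ¬ (s : Set Plane) ⊆ closedBall 0 (α - k) := fun h => hs3 ⟨hs1, h⟩
      obtain ⟨y, hys, hy⟩ := Set.not_subset.1 this
      refine ⟨y, ?_, hys⟩
      rw [hYdef, Finset.mem_filter, Set.Finite.mem_toFinset]
      rw [mem_closedBall, not_le] at hy
      exact ⟨⟨h𝒮.sub s hs1 y hys, hs2 hys⟩, hy.le⟩
    calc |∑ s ∈ G, F s| ≤ ∑ s ∈ G, |F s| := Finset.abs_sum_le_sum_abs _ _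
      _ ≤ ∑ s ∈ G, B := Finset.sum_le_sum fun s hs => hF s (hG s hs).1.1
      _ = B * G.card := by rw [Finset.sum_const, nsmul_eq_mul, mul_comm]
      _ ≤ B * (M * (2 * (k + 2 * r) / r ^ 2 * α)) := by
        refine mul_le_mul_of_nonneg_left (hcard.trans ?_) hB
        rw [mul_comm]
        exact mul_le_mul_of_nonneg_left hY (by positivity)
  have hmono : ∀ 𝒮 : Set (Finset Plane), inBall 𝒮 (α - k) ⊆ inBall 𝒮 α := fun 𝒮 s hs =>
    ⟨hs.1, hs.2.trans (closedBall_subset_closedBall (by linarith))⟩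
  have b1 := bound 𝒟 h𝒟 hF𝒟 (G \ H) (by
    intro s hs
    simp only [hG, hH, Finset.mem_sdiff, Set.Finite.mem_toFinset] at hs
    exact ⟨hs.1, fun h => hs.2 (hmono 𝒯 (heq ▸ h))⟩)
  have b2 := bound 𝒯 h𝒯 hF𝒯 (H \ G) (by
    intro s hs
    simp only [hG, hH, Finset.mem_sdiff, Set.Finite.mem_toFinset] at hs
    exact ⟨hs.1, fun h => hs.2 (hmono 𝒟 (heq ▸ h))⟩)
  have e := Finset.sum_sdiff_sub_sum_sdiff (s₁ := G) (s₂ := H) (f := F)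
  have c1 := le_abs_self (∑ s ∈ G \ H, F s)
  have c2 := neg_abs_le (∑ s ∈ H \ G, F s)
  have e2 : B * (M * (4 * (k + 2 * r) / r ^ 2)) * α =
      B * (M * (2 * (k + 2 * r) / r ^ 2 * α)) + B * (M * (2 * (k + 2 * r) / r ^ 2 * α)) := by ring
  rw [e2]
  linarith

lemma IsMesh.abs_sum_inBall_le (hr : 0 < r) (hX : DelaunaySet 2 X r R) (hQ : 0 ≤ Q)
    (h𝒯 : IsMesh X Q 𝒯) {F : Finset Plane → ℝ} {B : ℝ} (hB : 0 ≤ B) (hF : ∀ s ∈ 𝒯, |F s| ≤ B)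
    {α : ℝ} (hα : r ≤ α) :
    |∑ᶠ s ∈ inBall 𝒯 α, F s| ≤ B * (2 ^ ⌊((2 * Q + r) / r) ^ 2⌋₊ * (4 / r ^ 2)) * α ^ 2 := by
  set M : ℝ := 2 ^ ⌊((2 * Q + r) / r) ^ 2⌋₊ with hM
  rw [finsum_mem_eq_finite_toFinset_sum _ (h𝒯.finite_inBall hr hX α)]
  set G := (h𝒯.finite_inBall hr hX α).toFinset with hG
  set Y := (hX.finite_inter hr 0 α).toFinset with hYdef
  have hmem : ∀ s ∈ G, s ∈ inBall 𝒯 α := fun s hs => by simpa [hG] using hs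
  have hY : (Y.card : ℝ) ≤ 4 / r ^ 2 * α ^ 2 := by
    have := hX.card_le_of_subset_closedBall hr (Y := Y) (z := 0) (a := α)
      (fun y hy => ((Set.Finite.mem_toFinset _).1 hy).1) (by linarith)
      (fun y hy => ((Set.Finite.mem_toFinset _).1 hy).2)
    refine this.trans ?_
    rw [div_pow, div_mul_eq_mul_div]
    gcongr
    nlinarith
  have hcard : (G.card : ℝ) ≤ Y.card * M := by
    refine (Nat.cast_le.2 (card_le_of_meets hr hX hQ (fun s hs => h𝒯.sub s (hmem s hs).1)
      (fun s hs => h𝒯.rad s (hmem s hs).1) (Y := Y) fun s hs => ?_)).trans_eq (by push_cast; rfl)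
    obtain ⟨a, b, c, rfl, h⟩ := h𝒯.tri s (hmem s hs).1
    refine ⟨a, ?_, by simp⟩
    rw [hYdef, Set.Finite.mem_toFinset]
    exact ⟨h𝒯.sub _ (hmem _ hs).1 a (by simp), (hmem _ hs).2 (by simp)⟩
  calc |∑ s ∈ G, F s| ≤ ∑ s ∈ G, |F s| := Finset.abs_sum_le_sum_abs _ _
    _ ≤ ∑ s ∈ G, B := Finset.sum_le_sum fun s hs => hF s (hmem s hs).1
    _ = B * G.card := by rw [Finset.sum_const, nsmul_eq_mul, mul_comm]
    _ ≤ B * (M * (4 / r ^ 2 * α ^ 2)) := by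
      refine mul_le_mul_of_nonneg_left (hcard.trans ?_) hB
      rw [mul_comm]
      exact mul_le_mul_of_nonneg_left hY (by positivity)
    _ = _ := by ring

lemma liminf_le_liminf_of_le_add_div {u v : ℝ → ℝ} {A K C : ℝ}
    (hu : ∀ᶠ α in atTop, |u α| ≤ K) (hv : ∀ᶠ α in atTop, |v α| ≤ A)
    (huv : ∀ᶠ α in atTop, u α ≤ v α + C / α) : liminf u atTop ≤ liminf v atTop := by
  have bdd_ge : ∀ {w : ℝ → ℝ} {A : ℝ}, (∀ᶠ α in atTop, |w α| ≤ A) →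
      IsBoundedUnder (· ≥ ·) atTop w := fun h =>
    ⟨_, h.mono fun α hα => neg_le_of_abs_le hα⟩
  have bdd_le : ∀ {w : ℝ → ℝ} {A : ℝ}, (∀ᶠ α in atTop, |w α| ≤ A) →
      IsBoundedUnder (· ≤ ·) atTop w := fun h =>
    ⟨_, h.mono fun α hα => le_of_abs_le hα⟩
  refine le_of_forall_pos_le_add fun ε hε => ?_
  rw [← liminf_add_const atTop v ε (bdd_le hv).isCoboundedUnder_ge (bdd_ge hv)]
  have hlim : Tendsto (fun α : ℝ => C / α) atTop (nhds 0) := tendsto_const_nhds.div_atTop tendsto_id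
  refine liminf_le_liminf ?_ (bdd_ge hu) ?_
  · filter_upwards [huv, hlim.eventually_lt_const hε] with α h1 h2
    linarith
  · exact (bdd_le (A := A + ε) (hv.mono fun α hα => (abs_add_le _ _).trans
      (by rw [abs_of_pos hε]; linarith))).isCoboundedUnder_ge

lemma IsMesh.abs_le (hX : DelaunaySet 2 X r R) (h𝒯 : IsMesh X Q 𝒯) {F : Finset Plane → ℝ}
    {e E : ℝ} (hF : ∀ s : Finset Plane, s.card = 3 →
      (∀ u ∈ s, ∀ v ∈ s, u ≠ v → 2 * r ≤ dist u v) → HasCircumradiusLE 2 s Q → e ≤ F s ∧ F s ≤ E)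
    {s : Finset Plane} (hs : s ∈ 𝒯) : |F s| ≤ max |e| |E| := by
  obtain ⟨h1, h2⟩ := hF s (h𝒯.card hs)
    (fun u hu v hv huv => hX.two_mul_le_dist (h𝒯.sub s hs u hu) (h𝒯.sub s hs v hv) huv)
    (h𝒯.rad s hs)
  exact abs_le_max_abs_abs h1 h2

/-- The Delaunay mesh minimizes the sum of `F` over large balls up to a boundary term. -/
lemma IsMesh.sum_delaunay_le (hr : 0 < r) (hX : DelaunaySet 2 X r R) (hgen : Generic 2 X)
    (hQ : 0 ≤ Q) (h𝒯 : IsMesh X Q 𝒯) (h𝒟 : IsMesh X Q 𝒟) (h𝒟e : ∀ s ∈ 𝒟, EmptySimplex 2 s X)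
    {F : Finset Plane → ℝ} {e E : ℝ} (hF : ∀ s : Finset Plane, s.card = 3 →
      (∀ u ∈ s, ∀ v ∈ s, u ≠ v → 2 * r ≤ dist u v) → HasCircumradiusLE 2 s Q → e ≤ F s ∧ F s ≤ E)
    (hflip : FlipCondition F) {α : ℝ} (hα : 8 * Q + r ≤ α) :
    ∑ᶠ s ∈ inBall 𝒟 α, F s ≤ ∑ᶠ s ∈ inBall 𝒯 α, F s + max |e| |E| *
      (2 ^ ⌊((2 * Q + r) / r) ^ 2⌋₊ * (4 * (8 * Q + 2 * r) / r ^ 2)) * α := by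
  obtain ⟨𝒯', h𝒯', hle, hloc⟩ := exists_locallyDelaunay_mesh hr hX h𝒯 α hflip
  have := sum_inBall_le_add hr hX hQ h𝒯' h𝒟 (F := F) (B := max |e| |E|) (by positivity)
    (fun s hs => h𝒯'.abs_le hX hF hs) (fun s hs => h𝒟.abs_le hX hF hs) (by positivity) hα
    (hloc.inBall_eq hr hX hgen h𝒯' h𝒟 h𝒟e)
  linarith

lemma density_eq {F : Finset Plane → ℝ} {T : Geometry.SimplicialComplex ℝ Plane} :
    density 2 F T = liminf (fun α => (∑ᶠ s ∈ inBall {s | s ∈ T.faces ∧ s.card = 3} α, F s) /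
      volume.real (closedBall (0 : Plane) α)) atTop := by
  simp only [density, inBall, Set.mem_ofPred_eq, and_assoc]
  rfl

end Density

end Triangles

open scoped Classical in
/-- Main Theorem, planar case: if `F` satisfies the flip condition, then the Delaunay
triangulation minimizes the density of `F` among all uniformly bounded triangulations of a
generic Delaunay set in the plane.  In the flip condition, `y 0, y 1, y 2, y 3` are the
vertices of a convex quadrilateral in cyclic order (its diagonals cross), no four on a
common circle; `{y 0, y 1, y 2}, {y 0, y 2, y 3}` is its Delaunay triangulation (both
triangles empty) and `{y 0, y 1, y 3}, {y 1, y 2, y 3}` is the other triangulation. -/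
theorem main_theorem_planar (X : Set (EuclideanSpace ℝ (Fin 2))) (r R : ℝ)
    (hr : 0 < r) (hrR : r < R) (hX : DelaunaySet 2 X r R) (hgen : Generic 2 X)
    (D : Geometry.SimplicialComplex ℝ (EuclideanSpace ℝ (Fin 2)))
    (hD : IsDelaunayTriangulation 2 D X)
    (T : Geometry.SimplicialComplex ℝ (EuclideanSpace ℝ (Fin 2)))
    (hT : IsTriangulationOf 2 T X) (q : ℝ) (hq : 0 < q) (hTq : UniformlyBounded 2 T q)
    (F : Finset (EuclideanSpace ℝ (Fin 2)) → ℝ) (e E : ℝ)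
    (hF : ∀ s : Finset (EuclideanSpace ℝ (Fin 2)), s.card = 3 →
      (∀ u ∈ s, ∀ v ∈ s, u ≠ v → 2 * r ≤ dist u v) →
      HasCircumradiusLE 2 s (max q R) → e ≤ F s ∧ F s ≤ E)
    (hflip : ∀ y : Fin 4 → EuclideanSpace ℝ (Fin 2), Function.Injective y →
      (¬ ∃ c ρ, ∀ i, dist (y i) c = ρ) →
      (openSegment ℝ (y 0) (y 2) ∩ openSegment ℝ (y 1) (y 3)).Nonempty →
      EmptySimplex 2 {y 0, y 1, y 2} (Set.range y) →
      EmptySimplex 2 {y 0, y 2, y 3} (Set.range y) →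
      F {y 0, y 1, y 2} + F {y 0, y 2, y 3} ≤ F {y 0, y 1, y 3} + F {y 1, y 2, y 3}) :
    density 2 F D ≤ density 2 F T := by
  have hQ : 0 ≤ max q R := hq.le.trans (le_max_left _ _)
  have h𝒯 := hT.isMesh hr hX (Q := max q R) fun s hs h3 => (hTq s hs h3).mono (le_max_left _ _)
  have h𝒟 := hD.1.isMesh hr hX (Q := max q R) fun s hs h3 =>
    ((hD.2 s hs h3).hasCircumradiusLE hX).mono (le_max_right _ _)
  have hB : 0 ≤ max |e| |E| := by positivity
  have bounded : ∀ 𝒮 : Set (Finset Plane), IsMesh X (max q R) 𝒮 → ∀ᶠ α : ℝ in atTop,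
      |(∑ᶠ s ∈ inBall 𝒮 α, F s) / volume.real (closedBall (0 : Plane) α)| ≤
        max |e| |E| * (2 ^ ⌊((2 * max q R + r) / r) ^ 2⌋₊ * (4 / r ^ 2)) / Real.pi := by
    intro 𝒮 h𝒮
    filter_upwards [eventually_ge_atTop r] with α hα
    have hα0 : 0 < α := hr.trans_le hα
    rw [volume_real_closedBall_plane _ hα0.le, abs_div,
      abs_of_pos (a := α ^ 2 * Real.pi) (by positivity),
      div_le_div_iff₀ (by positivity) Real.pi_pos]
    have := h𝒮.abs_sum_inBall_le hr hX hQ hB (fun s hs => h𝒮.abs_le hX hF hs) hα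
    have := mul_le_mul_of_nonneg_right this Real.pi_pos.le
    linarith
  rw [density_eq, density_eq]
  refine liminf_le_liminf_of_le_add_div (bounded _ h𝒟) (bounded _ h𝒯)
    (C := max |e| |E| * (2 ^ ⌊((2 * max q R + r) / r) ^ 2⌋₊ *
      (4 * (8 * max q R + 2 * r) / r ^ 2)) / Real.pi) ?_
  filter_upwards [eventually_ge_atTop (8 * max q R + r)] with α hα
  have hα0 : 0 < α := by linarith
  have hle := h𝒯.sum_delaunay_le hr hX hgen hQ h𝒟 (fun s hs => hD.2 s hs.1 hs.2) hF hflip hα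
  rw [volume_real_closedBall_plane _ hα0.le]
  refine (div_le_div_of_nonneg_right hle (by positivity)).trans_eq ?_
  field_simp
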